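/- Let 𝒜 be a countable contracted set of disjoint α-paths in S², and suppose each α ∈ 𝒜 is given an extension α̂. Then there exist a set ℬ of disjoint β-paths in S², a bijection α ↦ β_α from 𝒜 to ℬ, and a bijective continuous map Φ : S² ∖ Im 𝒜 → S² ∖ Im ℬ that is a regluing of 𝒜 into ℬ; moreover, ℬ can be chosen to be contracted. -/

import Mathlib

open Set Filter Topology OnePoint

noncomputable section

abbrev Sph : Type := Metric.sphere (0 : EuclideanSpace ℝ (Fin 3)) 1

/-- The unit circle in the plane. -/
def circS : Set (ℝ × ℝ) := {p | p.1 ^ 2 + p.2 ^ 2 = 1}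

abbrev OP : Type := OnePoint (ℝ × ℝ)

/-- The closed outside `Δ̄∞` of the unit circle in the one-point compactification of the plane. -/
def deltaBar : Set OP := insert ∞ ((fun p : ℝ × ℝ => (p : OP)) '' {p | 1 ≤ p.1 ^ 2 + p.2 ^ 2})

/-- The unit circle viewed inside the one-point compactification of the plane. -/
def circOP : Set OP := (fun p : ℝ × ℝ => (p : OP)) '' circS

/-- The open outside `Δ∞` of the unit circle. -/
def deltaInf : Set OP := deltaBar \ circOP

/-- An α-path: `α (t₁,t₂) = α (t₁',t₂')` iff `t₁ = t₁'` and `t₂ = ±t₂'`. -/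
def IsAlphaPath (α : ℝ × ℝ → Sph) : Prop :=
  ContinuousOn α circS ∧
    ∀ p ∈ circS, ∀ q ∈ circS, (α p = α q ↔ p.1 = q.1 ∧ (p.2 = q.2 ∨ p.2 = -q.2))

/-- A β-path: `β (t₁,t₂) = β (t₁',t₂')` iff `t₁ = ±t₁'` and `t₂ = t₂'`. -/
def IsBetaPath (β : ℝ × ℝ → Sph) : Prop :=
  ContinuousOn β circS ∧
    ∀ p ∈ circS, ∀ q ∈ circS, (β p = β q ↔ (p.1 = q.1 ∨ p.1 = -q.1) ∧ p.2 = q.2)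

/-- The image of a path (its values on the unit circle). -/
def pathIm (α : ℝ × ℝ → Sph) : Set Sph := α '' circS

/-- `Im 𝒜`: the union of the images of the members of a family of paths. -/
def famIm (A : Set (ℝ × ℝ → Sph)) : Set Sph := ⋃ α ∈ A, pathIm α

/-- A family of paths with pairwise disjoint images. -/
def DisjointPaths (A : Set (ℝ × ℝ → Sph)) : Prop :=
  A.Pairwise fun α α' => Disjoint (pathIm α) (pathIm α')

/-- `ext` is an extension `α̂ : Δ̄∞ → S²` of the α-path `α`: it is continuous on `Δ̄∞`,
restricts to `α` on the unit circle, and maps `Δ∞` homeomorphically onto `S² ∖ α(S¹)`. -/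
def IsExtension (α : ℝ × ℝ → Sph) (ext : OP → Sph) : Prop :=
  ContinuousOn ext deltaBar ∧ (∀ p ∈ circS, ext (p : OP) = α p) ∧
    Topology.IsEmbedding (deltaInf.restrict ext) ∧ ext '' deltaInf = (pathIm α)ᶜ

/-- `Φ` is a regluing of the family `A` of α-paths (with chosen extensions `ext`) into the
family `B` of β-paths, according to the correspondence `b : α ↦ β_α`.  Only the values of `Φ`
on `S² ∖ Im A` matter: `Φ` restricts to a continuous bijection `S² ∖ Im A → S² ∖ Im B`, and
for every `α ∈ A` and `p ∈ S¹`, `Φ (α̂ z)` tends to `β_α p` as `z` tends to `p` within `Δ∞`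
(along the points where `Φ` is defined, i.e. where `α̂ z ∉ Im A`). -/
structure IsRegluing (A : Set (ℝ × ℝ → Sph)) (ext : (ℝ × ℝ → Sph) → OP → Sph)
    (B : Set (ℝ × ℝ → Sph)) (b : (ℝ × ℝ → Sph) → ℝ × ℝ → Sph) (Φ : Sph → Sph) : Prop where
  bijOn : Set.BijOn Φ (famIm A)ᶜ (famIm B)ᶜ
  contOn : ContinuousOn Φ (famIm A)ᶜ
  tendsto : ∀ α ∈ A, ∀ p ∈ circS,
    Filter.Tendsto (fun z => Φ (ext α z))
      (𝓝[deltaInf ∩ ext α ⁻¹' (famIm A)ᶜ] ((p : ℝ × ℝ) : OP)) (𝓝 (b α p))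

/-- The data of a set `A` of disjoint α-paths with chosen extensions `ext`, a set `B` of
disjoint β-paths, and a bijection `b : α ↦ β_α` from `A` to `B`. -/
structure RegluingData (A : Set (ℝ × ℝ → Sph)) (ext : (ℝ × ℝ → Sph) → OP → Sph)
    (B : Set (ℝ × ℝ → Sph)) (b : (ℝ × ℝ → Sph) → ℝ × ℝ → Sph) : Prop where
  alpha : ∀ α ∈ A, IsAlphaPath α
  disjA : DisjointPaths A
  extOk : ∀ α ∈ A, IsExtension α (ext α)
  beta : ∀ β ∈ B, IsBetaPath β
  disjB : DisjointPaths B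
  bij : Set.BijOn b A B

/-- A family of subsets of a metric space is contracted if for every `ε > 0` only finitely many
members have diameter exceeding `ε`. -/
def Contracted {X : Type*} [PseudoMetricSpace X] (S : Set (Set X)) : Prop :=
  ∀ ε > 0, {s ∈ S | ε < Metric.diam s}.Finite

section SecA
def SmS {X : Type*} [MetricSpace X] (K : Set X) (ε : ℝ) : Prop :=
  ∀ x ∈ K, ∀ y ∈ K, dist x y ≤ ε

structure Tower {X : Type*} [MetricSpace X] (φ : ℕ → X → X) (T : ℕ → Set X)
    (K : ℕ → ℕ → Set X) (η θ D : ℕ → ℝ) : Prop where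
  K_succ : ∀ k l, k < l → K (k+1) l = φ k '' K k l
  T_out : ∀ k x, x ∉ T k → φ k x = x
  T_in : ∀ k x, x ∈ T k → φ k x ∈ T k
  T_sub : ∀ k x, x ∈ T k → ∃ q ∈ K k k, dist x q < θ k
  θ_pos : ∀ k, 0 < θ k
  θ_le : ∀ k, θ k ≤ η k
  η_succ : ∀ k, η (k+1) ≤ θ k / 10
  η_zero : η 0 ≤ 1
  D_le : ∀ k, 100 * η k ≤ D k
  near : ∀ k l, k < l → ∀ p ∈ K k l, ∀ q ∈ K k k, dist p q < 3 * θ k → SmS (K (k+1) l) (η k)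
  sep : ∀ k l, k < l → ¬ SmS (K k l) (D k / 100) → ∀ p ∈ K k l, ∀ q ∈ K k k, 100 * η k ≤ dist p q
  contr : ∀ k, ∀ ε > 0, {l | k ≤ l ∧ ¬ SmS (K k l) ε}.Finite

namespace Tower
variable {X : Type*} [MetricSpace X] {φ : ℕ → X → X} {T : ℕ → Set X}
    {K : ℕ → ℕ → Set X} {η θ D : ℕ → ℝ}

lemma η_pos (h : Tower φ T K η θ D) (k) : 0 < η k := (h.θ_pos k).trans_le (h.θ_le k)

lemma η_lt (h : Tower φ T K η θ D) {k l} (hkl : k < l) : η l ≤ θ k / 10 := by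
  induction l, hkl using Nat.le_induction with
  | base => exact h.η_succ k
  | succ m hm ih =>
    have := h.η_succ m
    have := h.θ_le m
    have := h.η_pos m
    linarith

lemma η_pow (h : Tower φ T K η θ D) (k) : η k ≤ (1/10)^k := by
  induction k with
  | zero => simpa using h.η_zero
  | succ m ih =>
    have := h.η_succ m
    have := h.θ_le m
    rw [pow_succ]; linarith

lemma unch (h : Tower φ T K η θ D) {k l} (hkl : k < l)
    (hf : ∀ p ∈ K k l, ∀ q ∈ K k k, 3 * θ k ≤ dist p q) : K (k+1) l = K k l := by
  rw [h.K_succ k l hkl]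
  have : ∀ p ∈ K k l, φ k p = p := by
    intro p hp
    apply h.T_out
    intro hT
    obtain ⟨q, hq, hd⟩ := h.T_sub k p hT
    have := hf p hp q hq
    have := h.θ_pos k
    linarith
  ext y
  constructor
  · rintro ⟨p, hp, rfl⟩; rw [this p hp]; exact hp
  · intro hy; exact ⟨y, hy, this y hy⟩

lemma dich (h : Tower φ T K η θ D) {k l} (hkl : k < l) :
    SmS (K (k+1) l) (η k) ∨ ((∀ p ∈ K k l, ∀ q ∈ K k k, 3 * θ k ≤ dist p q) ∧ K (k+1) l = K k l) := by
  by_cases hf : ∀ p ∈ K k l, ∀ q ∈ K k k, 3 * θ k ≤ dist p q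
  · exact Or.inr ⟨hf, h.unch hkl hf⟩
  · push Not at hf
    obtain ⟨p, hp, q, hq, hd⟩ := hf
    exact Or.inl (h.near k l hkl p hp q hq hd)

lemma small (h : Tower φ T K η θ D) {k l} (hkl : k < l) :
    SmS (K l l) (η k) ∨ ((∀ p ∈ K k l, ∀ q ∈ K k k, 3 * θ k ≤ dist p q) ∧ K l l = K k l) := by
  have key : ∀ j, k < j → j ≤ l → SmS (K j l) (η k) ∨
      ((∀ p ∈ K k l, ∀ q ∈ K k k, 3 * θ k ≤ dist p q) ∧ K j l = K k l) := by
    intro j hj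
    induction j, hj using Nat.le_induction with
    | base => intro _; exact h.dich hkl
    | succ m hm ih =>
      intro hml
      rcases h.dich (k := m) (l := l) hml with h1 | ⟨_, h1⟩
      · left
        intro x hx y hy
        have := h1 x hx y hy
        have := h.η_lt hm
        have := h.θ_le k
        have := h.η_pos k
        linarith
      · rw [h1]; exact ih (by omega)
  exact key l hkl le_rfl

lemma first_move (h : Tower φ T K η θ D) {xs : ℕ → X} {m j : ℕ} (hmj : m ≤ j)
    (ho : ∀ i, m ≤ i → xs (i+1) = φ i (xs i)) :
    xs j = xs m ∨ ∃ l, m ≤ l ∧ l < j ∧ xs l = xs m ∧ xs l ∈ T l := by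
  induction j, hmj using Nat.le_induction with
  | base => left; rfl
  | succ n hn ih =>
    rcases ih with ih | ⟨l, h1, h2, h3, h4⟩
    · by_cases hT : xs n ∈ T n
      · exact Or.inr ⟨n, hn, by omega, ih, hT⟩
      · left; rw [ho n hn, h.T_out _ _ hT, ih]
    · exact Or.inr ⟨l, h1, by omega, h3, h4⟩

lemma T_sm (h : Tower φ T K η θ D) {l ε} (hs : SmS (K l l) ε) : SmS (T l) (ε + 2 * η l) := by
  intro x hx y hy
  obtain ⟨p, hp, hp'⟩ := h.T_sub l x hx
  obtain ⟨q, hq, hq'⟩ := h.T_sub l y hy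
  have := hs p hp q hq
  have := h.θ_le l
  have := dist_triangle4 x p q y
  rw [dist_comm q y] at this
  linarith

lemma motion (h : Tower φ T K η θ D) {xs : ℕ → X} (n : ℕ) : ∀ {k j : ℕ}, k < j → j - k ≤ n →
    (∀ i, k ≤ i → xs (i+1) = φ i (xs i)) → xs k ∈ T k → dist (xs j) (xs (k+1)) ≤ 2 * η k := by
  induction n with
  | zero => intro k j hkj hn; omega
  | succ n ih =>
    intro k j hkj hn ho hT
    have hη := h.η_pos k
    rcases h.first_move (m := k+1) (j := j) hkj (fun i hi => ho i (by omega)) with h1 | ⟨l, h1, h2, h3, h4⟩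
    · rw [h1, dist_self]; positivity
    · have hkl : k < l := h1
      have hx : xs l ∈ T k := by rw [h3, ho k le_rfl]; exact h.T_in _ _ hT
      have hsm : SmS (K l l) (η k) := by
        rcases h.small hkl with h5 | ⟨h5, h6⟩
        · exact h5
        · exfalso
          obtain ⟨p, hp, hp'⟩ := h.T_sub k _ hx
          obtain ⟨q, hq, hq'⟩ := h.T_sub l _ h4
          rw [h6] at hq
          have := h5 q hq p hp
          have := dist_triangle_left q p (xs l)
          have := h.η_lt hkl
          have := h.θ_le l
          have := h.θ_pos k
          linarith
      have h7 := h.T_sm hsm (xs (l+1)) (by rw [ho l (by omega)]; exact h.T_in _ _ h4) _ h4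
      have h8 := ih (k := l) (j := j) h2 (by omega) (fun i hi => ho i (by omega)) h4
      have := h.η_lt hkl
      have := h.θ_le k
      rw [← h3]
      have := dist_triangle (xs j) (xs (l+1)) (xs l)
      linarith

lemma sizes (h : Tower φ T K η θ D) {ε : ℝ} (hε : 0 < ε) : ∃ N, ∀ l, N ≤ l → SmS (K l l) ε := by
  obtain ⟨k, hk⟩ : ∃ k : ℕ, ((1:ℝ)/10)^k < ε := exists_pow_lt_of_lt_one hε (by norm_num)
  have hf := h.contr k ε hε
  obtain ⟨M, hM⟩ := hf.bddAbove
  refine ⟨max (M+1) (k+1), fun l hl => ?_⟩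
  have h1 : M < l := by have := le_max_left (M+1) (k+1); omega
  have h2 : k < l := by have := le_max_right (M+1) (k+1); omega
  have h3 : SmS (K k l) ε := by
    by_contra hc
    have := hM (show l ∈ {l | k ≤ l ∧ ¬ SmS (K k l) ε} from ⟨h2.le, hc⟩)
    omega
  rcases h.small h2 with h4 | ⟨_, h4⟩
  · intro x hx y hy
    exact (h4 x hx y hy).trans ((h.η_pow k).trans hk.le)
  · rw [h4]; exact h3

/-- uniform tail bound -/
lemma tail (h : Tower φ T K η θ D) {ε : ℝ} (hε : 0 < ε) : ∃ N, (∀ l, N ≤ l → SmS (T l) ε) ∧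
    ∀ m, N ≤ m → ∀ xs : ℕ → X, (∀ i, m ≤ i → xs (i+1) = φ i (xs i)) → ∀ j, m ≤ j →
      dist (xs j) (xs m) ≤ ε := by
  obtain ⟨N1, hN1⟩ := h.sizes (ε := ε/4) (by positivity)
  obtain ⟨k, hk⟩ : ∃ k : ℕ, ((1:ℝ)/10)^k < ε/8 := exists_pow_lt_of_lt_one (by positivity) (by norm_num)
  have hη : ∀ l, k ≤ l → η l ≤ ε / 8 := fun l hl =>
    (h.η_pow l).trans ((pow_le_pow_of_le_one (by norm_num) (by norm_num) hl).trans hk.le)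
  have hT : ∀ l, max N1 k ≤ l → SmS (T l) (ε/2) := by
    intro l hl x hx y hy
    have h1 := h.T_sm (hN1 l (le_trans (le_max_left _ _) hl)) x hx y hy
    have := hη l (le_trans (le_max_right _ _) hl)
    linarith
  refine ⟨max N1 k, fun l hl x hx y hy => (hT l hl x hx y hy).trans (by linarith), ?_⟩
  intro m hm xs ho j hj
  rcases h.first_move hj ho with h1 | ⟨l, h1, h2, h3, h4⟩
  · rw [h1, dist_self]; exact hε.le
  · have h5 := h.motion (xs := xs) _ h2 le_rfl (fun i hi => ho i (by omega)) h4
    have h6 := hT l (by omega) (xs (l+1)) (by rw [ho l (by omega)]; exact h.T_in _ _ h4) _ h4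
    have := hη l (by have := le_max_right N1 k; omega)
    have := dist_triangle (xs j) (xs (l+1)) (xs l)
    rw [← h3]; linarith

lemma apart (h : Tower φ T K η θ D) {xs ys : ℕ → X} {k : ℕ}
    (hx : ∀ i, k ≤ i → xs (i+1) = φ i (xs i)) (hy : ∀ i, k ≤ i → ys (i+1) = φ i (ys i))
    (hxT : xs k ∈ T k) (hyV : ∀ q ∈ K k k, D k ≤ dist (ys k) q) (j : ℕ) (hj : k < j) :
    η k ≤ dist (xs j) (ys j) := by
  have hη := h.η_pos k
  have hθ := h.θ_le k
  have hD := h.D_le k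
  have h1 := h.motion (xs := xs) _ hj le_rfl hx hxT
  have h2 : xs (k+1) ∈ T k := by rw [hx k le_rfl]; exact h.T_in _ _ hxT
  obtain ⟨q, hq, hq'⟩ := h.T_sub k _ h2
  have h3 : dist (xs j) q ≤ 3 * η k := by
    have := dist_triangle (xs j) (xs (k+1)) q
    linarith
  suffices h4 : 5 * η k ≤ dist (ys j) q by
    have := dist_triangle_left (ys j) q (xs j)
    linarith
  have h5 := hyV q hq
  rcases h.first_move (xs := ys) hj.le hy with e | ⟨l, l1, l2, l3, l4⟩
  · rw [e]; linarith
  · have hkl : k < l := by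
      rcases l1.lt_or_eq with h | rfl
      · exact h
      · exfalso
        obtain ⟨p, hp, hp'⟩ := h.T_sub k _ l4
        have := hyV p hp
        linarith
    have h6 := h.motion (xs := ys) _ l2 le_rfl (fun i hi => hy i (by omega)) l4
    have h7 : ys (l+1) ∈ T l := by rw [hy l (by omega)]; exact h.T_in _ _ l4
    have h8 := h.η_lt hkl
    have h9 := h.θ_le l
    have tri := dist_triangle (ys l) (ys (l+1)) q
    have tri2 := dist_triangle_left (ys (l+1)) q (ys j)
    rw [dist_comm (ys l) (ys (l+1))] at tri
    rw [← l3] at h5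
    rcases h.small hkl with s | ⟨_, s⟩
    · have := h.T_sm s _ h7 _ l4
      linarith
    · by_cases s2 : SmS (K k l) (D k / 100)
      · rw [← s] at s2
        have := h.T_sm s2 _ h7 _ l4
        linarith
      · obtain ⟨p, hp, hp'⟩ := h.T_sub l _ h7
        rw [s] at hp
        have := h.sep k l hkl s2 p hp q hq
        have := dist_triangle_left p q (ys (l+1))
        linarith
end Tower

end SecA

section SecB
lemma aux_ab {a b x y : ℝ} (ha : 0 ≤ a) (hab : a < b) (h : a * x = b * y) :
    y^2 ≤ x^2 ∧ (x^2 ≤ y^2 → x = 0) := by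
  have hb : 0 < b := by linarith
  have e : (a*x)^2 = (b*y)^2 := by rw [h]
  have e' : b^2 * (x^2 - y^2) = (b^2 - a^2) * x^2 := by nlinarith
  have hba : 0 < b^2 - a^2 := by nlinarith
  have hb2 : 0 < b^2 := by positivity
  constructor
  · have : 0 ≤ b^2 * (x^2 - y^2) := by rw [e']; positivity
    have := nonneg_of_mul_nonneg_right this hb2
    linarith
  · intro hxy
    have : b^2 * (x^2 - y^2) ≤ 0 := by nlinarith
    rw [e'] at this
    have h2 : x^2 ≤ 0 := by
      by_contra hc
      push Not at hc
      have := mul_pos hba hc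
      linarith
    have := sq_nonneg x
    exact pow_eq_zero_iff (two_ne_zero) |>.1 (le_antisymm h2 this)

lemma ell_fiber_lt {f g : ℝ → ℝ} (hf : StrictMono f) (hg : StrictMono g) (f0 : 0 ≤ f 0)
    (g0 : 0 ≤ g 0) {s s' : ℝ} {u u' : ℝ × ℝ} (hs : 0 ≤ s) (hss : s < s') (hu : u ∈ circS)
    (hu' : u' ∈ circS) (h1 : f s * u.1 = f s' * u'.1) (h2 : g s * u.2 = g s' * u'.2) : False := by
  have a1 := aux_ab (f0.trans (hf.monotone hs)) (hf hss) h1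
  have a2 := aux_ab (g0.trans (hg.monotone hs)) (hg hss) h2
  simp only [circS, mem_ofPred_eq] at hu hu'
  have b1 := a1.2 (by linarith [a2.1])
  have b2 := a2.2 (by linarith [a1.1])
  rw [b1, b2] at hu
  norm_num at hu

lemma ell_fiber_s {f g : ℝ → ℝ} (hf : StrictMono f) (hg : StrictMono g) (f0 : 0 ≤ f 0)
    (g0 : 0 ≤ g 0) {s s' : ℝ} {u u' : ℝ × ℝ} (hs : 0 ≤ s) (hs' : 0 ≤ s') (hu : u ∈ circS)
    (hu' : u' ∈ circS) (h1 : f s * u.1 = f s' * u'.1) (h2 : g s * u.2 = g s' * u'.2) : s = s' := by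
  rcases lt_trichotomy s s' with h | h | h
  · exact (ell_fiber_lt hf hg f0 g0 hs h hu hu' h1 h2).elim
  · exact h
  · exact (ell_fiber_lt hf hg f0 g0 hs' h hu' hu h1.symm h2.symm).elim

/-- fibers of the beta model -/
lemma ell_fiber {f g : ℝ → ℝ} (hf : StrictMono f) (hg : StrictMono g) (f0 : f 0 = 0)
    (g0 : 0 < g 0) {s s' : ℝ} {u u' : ℝ × ℝ} (hs : 0 ≤ s) (hs' : 0 ≤ s') (hu : u ∈ circS)
    (hu' : u' ∈ circS) (h1 : f s * u.1 = f s' * u'.1) (h2 : g s * u.2 = g s' * u'.2) :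
    s = s' ∧ u.2 = u'.2 ∧ (u.1 = u'.1 ∨ s = 0) := by
  have e := ell_fiber_s hf hg f0.ge g0.le hs hs' hu hu' h1 h2
  subst e
  refine ⟨rfl, ?_, ?_⟩
  · have : 0 < g s := g0.trans_le (hg.monotone hs)
    exact mul_left_cancel₀ this.ne' h2
  · rcases hs.eq_or_lt with h | h
    · right; exact h.symm
    · left
      have : 0 < f s := by rw [← f0]; exact hf h
      exact mul_left_cancel₀ this.ne' h1

lemma swap_circ {u : ℝ × ℝ} (hu : u ∈ circS) : (u.2, u.1) ∈ circS := by
  simp only [circS, mem_ofPred_eq] at *; linarith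

def ellM (f g : ℝ → ℝ) (q : ℝ × (ℝ × ℝ)) : ℝ × ℝ := (f q.1 * q.2.1, g q.1 * q.2.2)

def ellD (a b : ℝ) : Set (ℝ × ℝ) := {w | w.1^2 * b^2 + w.2^2 * a^2 ≤ a^2 * b^2}

def Cyl (ρ : ℝ) : Set (ℝ × (ℝ × ℝ)) := Icc 0 ρ ×ˢ circS

lemma ellM_mem {f g : ℝ → ℝ} (hf : StrictMono f) (hg : StrictMono g) (f0 : 0 ≤ f 0)
    (g0 : 0 ≤ g 0) {ρ : ℝ} {q} (hq : q ∈ Cyl ρ) : ellM f g q ∈ ellD (f ρ) (g ρ) := by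
  obtain ⟨⟨h1, h2⟩, hu⟩ := hq
  simp only [ellD, ellM, mem_ofPred_eq, circS] at *
  have a1 : 0 ≤ f q.1 := f0.trans (hf.monotone h1)
  have a2 : 0 ≤ g q.1 := g0.trans (hg.monotone h1)
  have a3 : f q.1 ^2 ≤ f ρ ^2 := by gcongr; exact hf.monotone h2
  have a4 : g q.1 ^2 ≤ g ρ ^2 := by gcongr; exact hg.monotone h2
  have b1 : (f q.1 * q.2.1)^2 * g ρ^2 ≤ q.2.1^2 * (f ρ^2 * g ρ^2) := by
    rw [mul_pow]
    have := mul_le_mul_of_nonneg_right a3 (show 0 ≤ q.2.1^2 * g ρ^2 by positivity)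
    linarith
  have b2 : (g q.1 * q.2.2)^2 * f ρ^2 ≤ q.2.2^2 * (f ρ^2 * g ρ^2) := by
    rw [mul_pow]
    have := mul_le_mul_of_nonneg_right a4 (show 0 ≤ q.2.2^2 * f ρ^2 by positivity)
    linarith
  calc _ ≤ (q.2.1^2 + q.2.2^2) * (f ρ^2 * g ρ^2) := by linarith
    _ = _ := by rw [hu, one_mul]

lemma ell_surj {f g : ℝ → ℝ} (hf : StrictMono f) (hg : StrictMono g) (cf : Continuous f)
    (cg : Continuous g) (f0 : f 0 = 0)
    (g0 : 0 < g 0) {ρ : ℝ} (hρ : 0 < ρ) {w : ℝ × ℝ} (hw : w ∈ ellD (f ρ) (g ρ)) :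
    ∃ q ∈ Cyl ρ, ellM f g q = w := by
  obtain ⟨x, y⟩ := w
  simp only [ellD, mem_ofPred_eq] at hw
  have fρ : 0 < f ρ := by rw [← f0]; exact hf hρ
  have gρ : 0 < g ρ := g0.trans (hg hρ)
  have hc : ContinuousOn (fun s => x^2 * g s^2 + y^2 * f s^2 - f s^2 * g s^2) (Icc 0 ρ) := by
    fun_prop
  obtain ⟨s, hs, he⟩ := intermediate_value_Icc' hρ.le hc (show (0:ℝ) ∈ _ by
    constructor
    · show x^2 * g ρ^2 + y^2 * f ρ^2 - f ρ^2 * g ρ^2 ≤ 0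
      linarith
    · show 0 ≤ x^2 * g 0^2 + y^2 * f 0^2 - f 0^2 * g 0^2
      rw [f0]; norm_num; positivity)
  simp only at he
  rcases hs.1.eq_or_lt with h | h
  · subst h
    rw [f0] at he
    have hx : x = 0 := by
      have : x^2 * g 0^2 = 0 := by linarith
      rcases mul_eq_zero.1 this with h | h
      · exact pow_eq_zero_iff two_ne_zero |>.1 h
      · have := pow_eq_zero_iff two_ne_zero |>.1 h
        linarith
    subst hx
    have hy : y^2 ≤ g ρ^2 := by
      have : 0 < f ρ^2 := by positivity
      by_contra hc
      push Not at hc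
      have := mul_lt_mul_of_pos_right hc this
      linarith
    have hy' : |y| ≤ g ρ := abs_le_of_sq_le_sq hy gρ.le
    by_cases hy0 : |y| ≤ g 0
    · refine ⟨(0, (√(1 - (y / g 0)^2), y / g 0)), ⟨⟨le_rfl, hρ.le⟩, ?_⟩, ?_⟩
      · simp only [circS, mem_ofPred_eq]
        rw [Real.sq_sqrt]
        · ring
        · have : (y/g 0)^2 ≤ 1 := by
            rw [div_pow, div_le_one (by positivity)]
            exact sq_le_sq' (by linarith [neg_abs_le y]) (by linarith [le_abs_self y])
          linarith
      · simp only [ellM, f0, zero_mul]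
        rw [mul_div_cancel₀ _ g0.ne']
    · push Not at hy0
      obtain ⟨t, ht, hte⟩ := intermediate_value_Icc hρ.le cg.continuousOn (show |y| ∈ _ from ⟨hy0.le, hy'⟩)
      have yp : 0 < |y| := g0.trans hy0
      refine ⟨(t, (0, y / |y|)), ⟨ht, ?_⟩, ?_⟩
      · simp only [circS, mem_ofPred_eq]
        rw [div_pow, sq_abs, div_self]
        · norm_num
        · have : y ≠ 0 := abs_pos.1 yp
          positivity
      · simp only [ellM, mul_zero, hte]
        rw [mul_div_cancel₀ _ yp.ne']
  · have fs : 0 < f s := by rw [← f0]; exact hf h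
    have gs : 0 < g s := g0.trans (hg h)
    refine ⟨(s, (x / f s, y / g s)), ⟨hs, ?_⟩, ?_⟩
    · simp only [circS, mem_ofPred_eq]
      field_simp
      linarith
    · simp only [ellM]
      rw [mul_div_cancel₀ _ fs.ne', mul_div_cancel₀ _ gs.ne']

lemma ell_surj' {f g : ℝ → ℝ} (hf : StrictMono f) (hg : StrictMono g) (cf : Continuous f)
    (cg : Continuous g) (f0 : 0 < f 0)
    (g0 : g 0 = 0) {ρ : ℝ} (hρ : 0 < ρ) {w : ℝ × ℝ} (hw : w ∈ ellD (f ρ) (g ρ)) :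
    ∃ q ∈ Cyl ρ, ellM f g q = w := by
  obtain ⟨q, hq, he⟩ := ell_surj hg hf cg cf g0 f0 hρ (w := (w.2, w.1)) (by
    simp only [ellD, mem_ofPred_eq] at *; linarith)
  refine ⟨(q.1, (q.2.2, q.2.1)), ⟨hq.1, swap_circ hq.2⟩, ?_⟩
  simp only [ellM, Prod.ext_iff] at *
  exact ⟨he.2, he.1⟩

lemma circS_compact : IsCompact circS := by
  have hcl : IsClosed circS := by
    unfold circS
    exact isClosed_eq (by fun_prop) (by fun_prop)
  refine (isCompact_Icc (a := ((-1:ℝ),(-1:ℝ))) (b := (1,1))).of_isClosed_subset hcl ?_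
  intro p hp
  simp only [circS, mem_ofPred_eq] at hp
  refine ⟨⟨?_, ?_⟩, ⟨?_, ?_⟩⟩ <;> simp only <;> nlinarith [sq_nonneg p.1, sq_nonneg p.2]

lemma circS_abs {u : ℝ × ℝ} (hu : u ∈ circS) : |u.1| ≤ 1 ∧ |u.2| ≤ 1 := by
  simp only [circS, mem_ofPred_eq] at hu
  constructor <;> rw [abs_le] <;> constructor <;> nlinarith [sq_nonneg u.1, sq_nonneg u.2]

lemma circS_preconn : IsPreconnected circS := by
  have : circS = range (fun t : ℝ => (Real.cos t, Real.sin t)) := by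
    ext ⟨x, y⟩
    simp only [circS, mem_ofPred_eq, mem_range, Prod.mk.injEq]
    constructor
    · intro h
      refine ⟨Complex.arg ⟨x, y⟩, ?_⟩
      have hn : ‖(⟨x, y⟩ : ℂ)‖ = 1 := by
        have : ‖(⟨x, y⟩ : ℂ)‖^2 = 1 := by
          rw [Complex.sq_norm, Complex.normSq_mk]; linarith
        nlinarith [norm_nonneg (⟨x, y⟩ : ℂ)]
      have hne : (⟨x, y⟩ : ℂ) ≠ 0 := by
        intro h0; rw [h0] at hn; simp at hn
      rw [Complex.cos_arg hne, Complex.sin_arg, hn]; simp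
    · rintro ⟨t, rfl, rfl⟩
      exact Real.cos_sq_add_sin_sq t
  rw [this]
  exact isPreconnected_range (by fun_prop)

lemma Cyl_compact (ρ : ℝ) : IsCompact (Cyl ρ) := isCompact_Icc.prod circS_compact

structure Collar {X : Type*} [MetricSpace X] (c : ℝ × (ℝ × ℝ) → X) (ρ : ℝ) : Prop where
  pos : 0 < ρ
  le_one : ρ ≤ 1
  cont : ContinuousOn c (Cyl ρ)
  inj : ∀ q ∈ Cyl ρ, ∀ q' ∈ Cyl ρ, c q = c q' →
    q.1 = q'.1 ∧ q.2.1 = q'.2.1 ∧ (q.2.2 = q'.2.2 ∨ (q.1 = 0 ∧ q.2.2 = -q'.2.2))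
  glue : ∀ u ∈ circS, c (0, u) = c (0, (u.1, -u.2))
  opn : ∀ r, 0 < r → r ≤ ρ → IsOpen (c '' (Ico 0 r ×ˢ circS))

lemma conj_circ {u : ℝ × ℝ} (hu : u ∈ circS) : (u.1, -u.2) ∈ circS := by
  simp only [circS, mem_ofPred_eq] at *; linarith [neg_sq u.2]

lemma sq_circ {u u' : ℝ × ℝ} (hu : u ∈ circS) (hu' : u' ∈ circS) (h : u.1 = u'.1) :
    u.2 = u'.2 ∨ u.2 = - u'.2 := by
  simp only [circS, mem_ofPred_eq] at *
  rw [h] at hu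
  exact sq_eq_sq_iff_eq_or_eq_neg.1 (by linarith)

lemma exists_chart {X : Type*} [MetricSpace X] {c : ℝ × (ℝ × ℝ) → X} {ρ : ℝ} (hc : Collar c ρ) :
    ∃ e : ℝ × ℝ → X, ContinuousOn e (ellD (1+ρ) ρ) ∧ InjOn e (ellD (1+ρ) ρ) ∧
      ∀ q ∈ Cyl ρ, e (ellM (fun s => 1 + s) (fun s => s) q) = c q := by
  classical
  set f : ℝ → ℝ := fun s => 1 + s
  set g : ℝ → ℝ := fun s => s
  have hf : StrictMono f := fun a b h => by simp only [f]; linarith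
  have hg : StrictMono g := fun a b h => h
  have cf : Continuous f := by fun_prop
  have cg : Continuous g := by fun_prop
  have f0 : 0 < f 0 := by simp [f]
  have g0 : g 0 = 0 := rfl
  have surj : ∀ w ∈ ellD (1+ρ) ρ, ∃ q ∈ Cyl ρ, ellM f g q = w := fun w hw =>
    ell_surj' hf hg cf cg f0 g0 hc.pos hw
  have hwd : ∀ q ∈ Cyl ρ, ∀ q' ∈ Cyl ρ, ellM f g q = ellM f g q' → c q = c q' := by
    rintro ⟨s, u⟩ hq ⟨s', u'⟩ hq' h
    simp only [ellM, Prod.mk.injEq] at h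
    obtain ⟨h1, h2, h3⟩ := ell_fiber hg hf g0 f0 hq.1.1 hq'.1.1 (swap_circ hq.2) (swap_circ hq'.2)
      h.2 h.1
    simp only at h1 h2 h3
    subst h1
    rcases h3 with h3 | h3
    · have : u = u' := Prod.ext h2 h3
      rw [this]
    · rcases sq_circ hq.2 hq'.2 h2 with h4 | h4
      · have : u = u' := Prod.ext h2 h4
        rw [this]
      · subst h3
        rw [hc.glue u' hq'.2]
        have : u = (u'.1, -u'.2) := Prod.ext h2 h4
        rw [this]
  have hwd' : ∀ q ∈ Cyl ρ, ∀ q' ∈ Cyl ρ, c q = c q' → ellM f g q = ellM f g q' := by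
    rintro ⟨s, u⟩ hq ⟨s', u'⟩ hq' h
    obtain ⟨h1, h2, h3⟩ := hc.inj _ hq _ hq' h
    simp only at h1 h2 h3
    subst h1
    rcases h3 with h3 | ⟨h3, h4⟩
    · simp [ellM, h2, h3]
    · subst h3; simp [ellM, h2, g]
  let e : ℝ × ℝ → X := fun w => if h : ∃ q ∈ Cyl ρ, ellM f g q = w then c h.choose else
    c (0, (1, 0))
  have he : ∀ q ∈ Cyl ρ, e (ellM f g q) = c q := by
    intro q hq
    have h : ∃ q' ∈ Cyl ρ, ellM f g q' = ellM f g q := ⟨q, hq, rfl⟩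
    simp only [e, dif_pos h]
    exact hwd _ h.choose_spec.1 _ hq h.choose_spec.2
  have hM : Continuous (ellM f g) := by unfold ellM; fun_prop
  refine ⟨e, ?_, ?_, he⟩
  · rw [continuousOn_iff_isClosed]
    intro F hF
    refine ⟨ellM f g '' (Cyl ρ ∩ c ⁻¹' F), ?_, ?_⟩
    · have h1 : IsClosed (Cyl ρ ∩ c ⁻¹' F) := hc.cont.preimage_isClosed_of_isClosed (Cyl_compact ρ).isClosed hF
      have h2 : IsCompact (Cyl ρ ∩ c ⁻¹' F) := (Cyl_compact ρ).of_isClosed_subset h1 inter_subset_left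
      exact (h2.image hM).isClosed
    · ext w
      constructor
      · rintro ⟨h1, h2⟩
        obtain ⟨q, hq, rfl⟩ := surj w h2
        refine ⟨⟨q, ⟨hq, ?_⟩, rfl⟩, h2⟩
        simpa [he q hq] using h1
      · rintro ⟨⟨q, ⟨hq, hqF⟩, rfl⟩, h2⟩
        refine ⟨?_, h2⟩
        simpa [he q hq] using hqF
  · intro w hw w' hw' h
    obtain ⟨q, hq, rfl⟩ := surj w hw
    obtain ⟨q', hq', rfl⟩ := surj w' hw'
    rw [he q hq, he q' hq'] at h
    exact hwd' q hq q' hq' h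

end SecB

section SecC
lemma swap_map {X : Type*} [MetricSpace X] {c G : ℝ × (ℝ × ℝ) → X} {ρ r : ℝ} (hc : Collar c ρ)
    (hr : 0 < r) (hrρ : r < ρ) (Gc : ContinuousOn G (Cyl ρ))
    (Ginj : ∀ q ∈ Cyl ρ, ∀ q' ∈ Cyl ρ, G q = G q' →
      q.1 = q'.1 ∧ q.2.2 = q'.2.2 ∧ (q.2.1 = q'.2.1 ∨ q.1 = 0))
    (Gim : G '' Cyl ρ = c '' Cyl ρ) (Gout : ∀ q ∈ Cyl ρ, r ≤ q.1 → G q = c q) :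
    ∃ φ : X → X, (∀ q ∈ Cyl ρ, 0 < q.1 → φ (c q) = G q) ∧
      (∀ x, x ∉ c '' (Ico 0 r ×ˢ circS) → φ x = x) ∧
      (∀ x, x ∈ c '' (Ico 0 r ×ˢ circS) → φ x ∈ c '' (Ico 0 r ×ˢ circS)) ∧
      (∀ u ∈ circS, G (0, u) ∈ c '' (Ico 0 r ×ˢ circS)) ∧
      ContinuousOn φ ((fun u => c (0, u)) '' circS)ᶜ ∧
      BijOn φ ((fun u => c (0, u)) '' circS)ᶜ ((fun u => G (0, u)) '' circS)ᶜ ∧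
      (∀ U, IsOpen U → U ⊆ ((fun u => c (0, u)) '' circS)ᶜ → IsOpen (φ '' U)) := by
  classical
  set T := c '' (Ico 0 r ×ˢ circS) with hTdef
  set a := (fun u => c (0, u)) '' circS with ha
  set b := (fun u => G (0, u)) '' circS with hb
  have hTo : IsOpen T := hc.opn r hr hrρ.le
  have hTC : ∀ q, q ∈ Cyl ρ → q.1 < r → c q ∈ T := fun q hq h => ⟨q, ⟨⟨hq.1.1, h⟩, hq.2⟩, rfl⟩
  have hTex : ∀ x ∈ T, ∃ q ∈ Cyl ρ, q.1 < r ∧ c q = x := by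
    rintro x ⟨q, hq, rfl⟩
    exact ⟨q, ⟨⟨hq.1.1, hq.1.2.le.trans hrρ.le⟩, hq.2⟩, hq.1.2, rfl⟩
  have hTlt : ∀ q ∈ Cyl ρ, c q ∈ T → q.1 < r := by
    intro q hq h
    obtain ⟨q', h1, h2, h3⟩ := hTex _ h
    have := (hc.inj _ h1 _ hq h3).1
    linarith
  have hapos : ∀ q ∈ Cyl ρ, c q ∉ a → 0 < q.1 := by
    intro q hq h
    rcases hq.1.1.eq_or_lt with h1 | h1
    · exact (h ⟨q.2, hq.2, by simp only; congr 1; exact Prod.ext h1 rfl⟩).elim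
    · exact h1
  have h0C : ∀ u ∈ circS, ((0:ℝ), u) ∈ Cyl ρ := fun u hu => ⟨⟨le_rfl, hc.pos.le⟩, hu⟩
  have hapos' : ∀ q ∈ Cyl ρ, 0 < q.1 → c q ∉ a := by
    rintro q hq h ⟨u, hu, he⟩
    have := (hc.inj _ (h0C u hu) _ hq he).1
    simp only at this
    linarith
  have hGT : ∀ q ∈ Cyl ρ, q.1 < r → G q ∈ T := by
    intro q hq h
    have : G q ∈ c '' Cyl ρ := Gim ▸ mem_image_of_mem G hq
    obtain ⟨q', hq', he⟩ := this
    rw [← he]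
    apply hTC _ hq'
    by_contra hn
    push Not at hn
    rw [← Gout _ hq' hn] at he
    have := (Ginj _ hq' _ hq he).1
    linarith
  have hTG : ∀ x ∈ T, ∃ q ∈ Cyl ρ, q.1 < r ∧ G q = x := by
    intro x hx
    obtain ⟨q', h1, h2, h3⟩ := hTex _ hx
    have : x ∈ G '' Cyl ρ := Gim ▸ h3 ▸ mem_image_of_mem c h1
    obtain ⟨q, hq, he⟩ := this
    refine ⟨q, hq, ?_, he⟩
    by_contra hn
    push Not at hn
    rw [Gout _ hq hn, ← h3] at he
    have := (hc.inj _ hq _ h1 he).1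
    linarith
  have hGi : ∀ q ∈ Cyl ρ, ∀ q' ∈ Cyl ρ, G q = G q' → 0 < q.1 → q = q' := by
    intro q hq q' hq' h h0
    obtain ⟨h1, h2, h3⟩ := Ginj q hq q' hq' h
    rcases h3 with h3 | h3
    · exact Prod.ext h1 (Prod.ext h3 h2)
    · linarith
  have hci : ∀ q ∈ Cyl ρ, ∀ q' ∈ Cyl ρ, c q = c q' → 0 < q.1 → q = q' := by
    intro q hq q' hq' h h0
    obtain ⟨h1, h2, h3⟩ := hc.inj q hq q' hq' h
    rcases h3 with h3 | h3
    · exact Prod.ext h1 (Prod.ext h2 h3)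
    · linarith
  let φ : X → X := fun x => if h : ∃ q ∈ Cyl ρ, 0 < q.1 ∧ c q = x then G h.choose else x
  have hφc : ∀ q ∈ Cyl ρ, 0 < q.1 → φ (c q) = G q := by
    intro q hq h0
    have h : ∃ q' ∈ Cyl ρ, 0 < q'.1 ∧ c q' = c q := ⟨q, hq, h0, rfl⟩
    simp only [φ, dif_pos h]
    rw [← hci q hq _ h.choose_spec.1 h.choose_spec.2.2.symm h0]
  have hout : ∀ x, x ∉ T → φ x = x := by
    intro x hx
    by_cases h : ∃ q ∈ Cyl ρ, 0 < q.1 ∧ c q = x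
    · obtain ⟨q, hq, h0, rfl⟩ := h
      rw [hφc q hq h0]
      apply Gout q hq
      by_contra hn
      push Not at hn
      exact hx (hTC q hq hn)
    · simp only [φ, dif_neg h]
  have hin : ∀ x, x ∈ T → φ x ∈ T := by
    intro x hx
    by_cases h : ∃ q ∈ Cyl ρ, 0 < q.1 ∧ c q = x
    · obtain ⟨q, hq, h0, rfl⟩ := h
      rw [hφc q hq h0]
      exact hGT q hq (hTlt q hq hx)
    · simp only [φ, dif_neg h]; exact hx
  have hTa : ∀ x ∈ T, x ∉ a → ∃ q ∈ Cyl ρ, 0 < q.1 ∧ q.1 < r ∧ c q = x := by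
    intro x hx hxa
    obtain ⟨q, hq, h1, rfl⟩ := hTex x hx
    exact ⟨q, hq, hapos q hq hxa, h1, rfl⟩
  have hbT : ∀ u ∈ circS, G (0, u) ∈ T := fun u hu => hGT _ (h0C u hu) hr
  have cpt : ∀ {f g : ℝ × (ℝ × ℝ) → X} {F : Set X}, ContinuousOn f (Cyl ρ) → ContinuousOn g (Cyl ρ) →
      IsClosed F → IsClosed (f '' (Cyl ρ ∩ g ⁻¹' F)) := by
    intro f g F hf hg hF
    have h1 : IsClosed (Cyl ρ ∩ g ⁻¹' F) := hg.preimage_isClosed_of_isClosed (Cyl_compact ρ).isClosed hF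
    have h2 : IsCompact (Cyl ρ ∩ g ⁻¹' F) := (Cyl_compact ρ).of_isClosed_subset h1 inter_subset_left
    exact (h2.image_of_continuousOn (hf.mono inter_subset_left)).isClosed
  refine ⟨φ, hφc, hout, hin, hbT, ?_, ⟨?_, ?_, ?_⟩, ?_⟩
  · rw [continuousOn_iff_isClosed]
    intro F hF
    refine ⟨(Tᶜ ∩ F) ∪ c '' (Cyl ρ ∩ G ⁻¹' F), (hTo.isClosed_compl.inter hF).union
      (cpt hc.cont Gc hF), ?_⟩
    ext x
    constructor
    · rintro ⟨h1, h2⟩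
      refine ⟨?_, h2⟩
      by_cases hx : x ∈ T
      · right
        obtain ⟨q, hq, h0, h3, rfl⟩ := hTa x hx h2
        refine ⟨q, ⟨hq, ?_⟩, rfl⟩
        have h1' : φ (c q) ∈ F := h1
        rwa [hφc q hq h0] at h1'
      · left
        have h1' : φ x ∈ F := h1
        rw [hout x hx] at h1'
        exact ⟨hx, h1'⟩
    · rintro ⟨h1, h2⟩
      refine ⟨?_, h2⟩
      show φ x ∈ F
      rcases h1 with ⟨h1, h3⟩ | ⟨q, ⟨hq, h3⟩, rfl⟩
      · rw [hout x h1]; exact h3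
      · rw [hφc q hq (hapos q hq h2)]; exact h3
  · intro x hx hxb
    by_cases hxT : x ∈ T
    · obtain ⟨q, hq, h0, h3, rfl⟩ := hTa x hxT hx
      rw [hφc q hq h0] at hxb
      obtain ⟨u, hu, he⟩ := hxb
      have := (Ginj _ (h0C u hu) _ hq he).1
      simp only at this
      linarith
    · rw [hout x hxT] at hxb
      obtain ⟨u, hu, he⟩ := hxb
      exact hxT (he ▸ hbT u hu)
  · intro x hx y hy h
    by_cases hxT : x ∈ T <;> by_cases hyT : y ∈ T
    · obtain ⟨q, hq, h0, h3, rfl⟩ := hTa x hxT hx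
      obtain ⟨q', hq', h0', h3', rfl⟩ := hTa y hyT hy
      rw [hφc q hq h0, hφc q' hq' h0'] at h
      rw [hGi q hq q' hq' h h0]
    · rw [hout y hyT] at h
      exact (hyT (h ▸ hin x hxT)).elim
    · rw [hout x hxT] at h
      exact (hxT (h ▸ hin y hyT)).elim
    · rwa [hout x hxT, hout y hyT] at h
  · intro y hy
    by_cases hyT : y ∈ T
    · obtain ⟨q, hq, h1, rfl⟩ := hTG y hyT
      have h0 : 0 < q.1 := by
        rcases hq.1.1.eq_or_lt with h | h
        · exact (hy ⟨q.2, hq.2, by simp only; congr 1; exact Prod.ext h rfl⟩).elim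
        · exact h
      exact ⟨c q, hapos' q hq h0, hφc q hq h0⟩
    · refine ⟨y, ?_, hout y hyT⟩
      rintro ⟨u, hu, he⟩
      exact hyT (he ▸ hTC _ (h0C u hu) hr)
  · intro U hU hUa
    have : (φ '' U)ᶜ = (Tᶜ ∩ Uᶜ) ∪ G '' (Cyl ρ ∩ c ⁻¹' Uᶜ) := by
      ext y
      constructor
      · intro hy
        by_cases hyT : y ∈ T
        · right
          obtain ⟨q, hq, h1, rfl⟩ := hTG y hyT
          refine ⟨q, ⟨hq, ?_⟩, rfl⟩
          intro hqU
          exact hy ⟨c q, hqU, hφc q hq (hapos q hq (hUa hqU))⟩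
        · left
          exact ⟨hyT, fun hyU => hy ⟨y, hyU, hout y hyT⟩⟩
      · rintro (⟨h1, h2⟩ | ⟨q, ⟨hq, h1⟩, rfl⟩) ⟨x, hxU, hx⟩
        · by_cases hxT : x ∈ T
          · exact h1 (hx ▸ hin x hxT)
          · rw [hout x hxT] at hx
            exact h2 (hx ▸ hxU)
        · by_cases hxT : x ∈ T
          · obtain ⟨q', hq', h0', h3', rfl⟩ := hTa x hxT (hUa hxU)
            rw [hφc q' hq' h0'] at hx
            have := hGi q' hq' q hq hx h0'
            exact h1 (this ▸ hxU)
          · rw [hout x hxT] at hx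
            have : r ≤ q.1 := by
              by_contra hn
              push Not at hn
              exact hxT (hx ▸ hGT q hq hn)
            rw [Gout q hq this] at hx
            exact h1 (hx ▸ hxU)
    rw [← isClosed_compl_iff, this]
    exact (hTo.isClosed_compl.inter hU.isClosed_compl).union (cpt Gc hc.cont hU.isClosed_compl)

end SecC

section SecD
lemma glue_fn {f g : ℝ → ℝ} {τ : ℝ} (hf : StrictMono f) (hg : StrictMono g) (cf : Continuous f)
    (cg : Continuous g) (h : f τ = g τ) :
    StrictMono (fun s => if s ≤ τ then f s else g s) ∧ Continuous (fun s => if s ≤ τ then f s else g s) := by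
  constructor
  · intro x y hxy
    by_cases hx : x ≤ τ <;> by_cases hy : y ≤ τ <;> simp only [hx, hy, if_true, if_false]
    · exact hf hxy
    · push Not at hy
      calc f x ≤ f τ := hf.monotone hx
        _ = g τ := h
        _ < g y := hg hy
    · exact (hx (hxy.le.trans hy)).elim
    · exact hg hxy
  · exact Continuous.if_le cf cg continuous_id continuous_const (by rintro x rfl; exact h)

lemma osc_fun {𝒦 : Set (Set ℝ)} {ρ : ℝ} (hP : ∀ σ, 0 < σ → σ ≤ ρ → ∃ σ', 0 < σ' ∧ σ' < σ ∧
      ∀ J ∈ 𝒦, (∃ s ∈ J, s ≤ σ') → ∀ s ∈ J, s < σ) (hpos : ∀ J ∈ 𝒦, ∀ s ∈ J, 0 < s) (N : ℕ) :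
    ∀ σ, 0 < σ → σ ≤ ρ → ∃ (f : ℝ → ℝ) (τ : ℝ), StrictMono f ∧ Continuous f ∧ f 0 = 0 ∧ f σ = N + 1 ∧
      0 < τ ∧ τ < σ ∧ N ≤ f τ ∧ (∀ J ∈ 𝒦, (∃ s ∈ J, s ≤ τ) → ∀ s ∈ J, s < σ) ∧
      ∀ J ∈ 𝒦, (∀ s ∈ J, s < σ) → ∀ s ∈ J, ∀ s' ∈ J, |f s - f s'| ≤ 2 := by
  induction N with
  | zero =>
    intro σ h0 hσ
    obtain ⟨τ, t0, t1, t2⟩ := hP σ h0 hσ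
    refine ⟨fun s => s / σ, τ, ?_, by fun_prop, by simp, by simp [h0.ne'], t0, t1, ?_, t2, ?_⟩
    · intro a b hab; exact div_lt_div_of_pos_right hab h0
    · simp; positivity
    · intro J hJ hJσ s hs s' hs'
      have a1 := div_nonneg (hpos J hJ s hs).le h0.le
      have a2 := div_nonneg (hpos J hJ s' hs').le h0.le
      have a3 := (div_le_one h0).2 (hJσ s hs).le
      have a4 := (div_le_one h0).2 (hJσ s' hs').le
      rw [abs_le]; constructor <;> linarith
  | succ N ih =>
    intro σ h0 hσ
    obtain ⟨τ, t0, t1, t2⟩ := hP σ h0 hσ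
    obtain ⟨f, τ', f1, f2, f3, f4, f5, f6, f7, f8, f9⟩ := ih τ t0 (t1.le.trans hσ)
    have hd : 0 < σ - τ := by linarith
    set g : ℝ → ℝ := fun s => (N + 1) + (s - τ) / (σ - τ) with hg
    have g1 : StrictMono g := by
      intro a b hab
      have := div_lt_div_of_pos_right (show a - τ < b - τ by linarith) hd
      simp only [hg]; linarith
    have g2 : Continuous g := by fun_prop
    have hfg : f τ = g τ := by simp [hg, f4]
    obtain ⟨k1, k2⟩ := glue_fn f1 g1 f2 g2 hfg
    set k : ℝ → ℝ := fun s => if s ≤ τ then f s else g s with hk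
    have kτ : k τ = N + 1 := by simp [hk, f4]
    have kσ : k σ = N + 1 + 1 := by
      simp only [hk, if_neg (not_le.2 t1), hg]
      rw [div_self hd.ne']
    refine ⟨k, τ, k1, k2, ?_, ?_, t0, t1, ?_, t2, ?_⟩
    · simp [hk, t0.le, f3]
    · rw [kσ]; push_cast; rfl
    · rw [kτ]; push_cast; rfl
    · intro J hJ hJσ s hs s' hs'
      by_cases hJτ : ∀ s ∈ J, s < τ
      · simp only [hk, if_pos (hJτ s hs).le, if_pos (hJτ s' hs').le]
        exact f9 J hJ hJτ s hs s' hs'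
      · have hb : ∀ s ∈ J, (N:ℝ) ≤ k s ∧ k s ≤ N + 2 := by
          intro s hs
          have h1 : τ' < s := by
            by_contra hn
            push Not at hn
            exact hJτ (f8 J hJ ⟨s, hs, hn⟩)
          have h2 : k τ' ≤ k s := k1.monotone h1.le
          have h3 : k τ' = f τ' := by simp [hk, f6.le]
          have h4 : k s ≤ k σ := k1.monotone (hJσ s hs).le
          constructor <;> linarith
        have := hb s hs
        have := hb s' hs'
        rw [abs_le]; constructor <;> linarith

lemma osc_fun2 {𝒦 : Set (Set ℝ)} {ρ : ℝ} (hρ : ρ ≤ 1) (hP : ∀ σ, 0 < σ → σ ≤ ρ → ∃ σ', 0 < σ' ∧ σ' < σ ∧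
      ∀ J ∈ 𝒦, (∃ s ∈ J, s ≤ σ') → ∀ s ∈ J, s < σ) (hpos : ∀ J ∈ 𝒦, ∀ s ∈ J, 0 < s)
    {ε r r0 : ℝ} (hε : 0 < ε) (hr : 0 < r) (hrr : r < r0) (hr0 : r0 ≤ ρ)
    (hJ0 : ∀ J ∈ 𝒦, (∃ s ∈ J, s ≤ r) → ∀ s ∈ J, s < r0) :
    ∃ f : ℝ → ℝ, StrictMono f ∧ Continuous f ∧ f 0 = 0 ∧ (∀ s, r ≤ s → f s = 1 + s) ∧
      ∀ J ∈ 𝒦, (∃ s ∈ J, s ≤ r) → ∀ s ∈ J, ∀ s' ∈ J, |f s - f s'| ≤ ε + r0 := by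
  obtain ⟨N, hN⟩ := exists_nat_gt (4 / ε)
  obtain ⟨f, τ, f1, f2, f3, f4, f5, f6, f7, f8, f9⟩ := osc_fun hP hpos N r hr (hrr.le.trans hr0)
  have hNp : (0:ℝ) < N + 1 := by positivity
  set κ : ℝ := (1 + r) / (N + 1) with hκ
  have κp : 0 < κ := by positivity
  have κε : κ * 2 ≤ ε := by
    have h1 : 4 < ε * (N + 1) := by
      rw [div_lt_iff₀ hε] at hN; linarith
    rw [hκ, div_mul_eq_mul_div, div_le_iff₀ hNp]; linarith
  have κN : κ * (N + 1) = 1 + r := by rw [hκ]; field_simp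
  have g1 : StrictMono (fun s => κ * f s) := fun a b hab => mul_lt_mul_of_pos_left (f1 hab) κp
  have h1 : StrictMono (fun s : ℝ => 1 + s) := fun a b hab => by simp only; linarith
  have hfg : (fun s => κ * f s) r = (fun s : ℝ => 1 + s) r := by simp only [f4, κN]
  obtain ⟨k1, k2⟩ := glue_fn g1 h1 (by fun_prop) (by fun_prop) hfg
  set k : ℝ → ℝ := fun s => if s ≤ r then κ * f s else 1 + s with hk
  have kr : ∀ s, r ≤ s → k s = 1 + s := by
    intro s hs
    rcases hs.eq_or_lt with rfl | hs
    · simp only [hk, le_refl, if_true]; exact hfg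
    · simp only [hk, if_neg (not_le.2 hs)]
  refine ⟨k, k1, k2, by simp [hk, hr.le, f3], kr, ?_⟩
  intro J hJ hJr s hs s' hs'
  by_cases hJτ : ∀ s ∈ J, s < r
  · simp only [hk, if_pos (hJτ s hs).le, if_pos (hJτ s' hs').le]
    rw [← mul_sub, abs_mul, abs_of_pos κp]
    have := mul_le_mul_of_nonneg_left (f9 J hJ hJτ s hs s' hs') κp.le
    linarith
  · have hb : ∀ s ∈ J, 1 + r - κ ≤ k s ∧ k s ≤ 1 + r0 := by
      intro s hs
      have h1 : τ < s := by
        by_contra hn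
        push Not at hn
        exact hJτ (f8 J hJ ⟨s, hs, hn⟩)
      have h2 : k τ ≤ k s := k1.monotone h1.le
      have h3 : k τ = κ * f τ := by simp [hk, f6.le]
      have h4 : k s ≤ k r0 := k1.monotone (hJ0 J hJ hJr s hs).le
      rw [kr r0 hrr.le] at h4
      have h5 := mul_le_mul_of_nonneg_left f7 κp.le
      constructor <;> linarith
    have := hb s hs
    have := hb s' hs'
    rw [abs_le]; constructor <;> linarith

variable {X : Type*} [MetricSpace X]

lemma avoid {a : Set X} (ha : IsCompact a) {K : ℕ → Set X} {S : Set ℕ}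
    (hK : ∀ l ∈ S, IsClosed (K l)) (disj : ∀ l ∈ S, Disjoint (K l) a)
    (contr : ∀ ε > 0, {l | l ∈ S ∧ ¬ SmS (K l) ε}.Finite) {ε : ℝ} (hε : 0 < ε) :
    ∃ δ > 0, ∀ l ∈ S, ∀ p ∈ K l, ∀ q ∈ a, dist p q < δ → SmS (K l) ε := by
  have hcl : IsClosed (⋃ l ∈ {l | l ∈ S ∧ ¬ SmS (K l) ε}, K l) :=
    (contr ε hε).isClosed_biUnion (fun l hl => hK l hl.1)
  obtain ⟨δ, hδ, hsub⟩ := ha.exists_thickening_subset_open hcl.isOpen_compl (by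
    intro x hx hx'
    simp only [mem_iUnion] at hx'
    obtain ⟨l, hl, hxl⟩ := hx'
    exact (disj l hl.1).le_bot ⟨hxl, hx⟩)
  refine ⟨δ, hδ, fun l hl p hp q hq hd => ?_⟩
  by_contra hn
  refine hsub (Metric.mem_thickening_iff.2 ⟨q, hq, hd⟩) ?_
  simp only [mem_iUnion]
  exact ⟨l, ⟨hl, hn⟩, hp⟩

def cjq (q : ℝ × (ℝ × ℝ)) : ℝ × (ℝ × ℝ) := (q.1, (q.2.1, -q.2.2))

lemma lift_small {c : ℝ × (ℝ × ℝ) → X} {ρ : ℝ} (hc : Collar c ρ) {ε : ℝ} (hε : 0 < ε) :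
    ∃ δ > 0, ∀ K : Set X, IsPreconnected K → SmS K δ → (∀ x ∈ K, ∃ q ∈ Cyl ρ, 0 < q.1 ∧ c q = x) →
      ∀ q ∈ Cyl ρ, ∀ q' ∈ Cyl ρ, c q ∈ K → c q' ∈ K → dist q q' ≤ ε := by
  have hcj : Continuous cjq := by unfold cjq; fun_prop
  set ε' := ε / 4 with hε'
  have e0 : 0 < ε' := by positivity
  have claim : ∃ δ > 0, ∀ q ∈ Cyl ρ, ∀ q' ∈ Cyl ρ, dist (c q) (c q') ≤ δ →
      dist q q' < ε' ∨ dist (cjq q) q' < ε' := by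
    set S : Set ((ℝ × (ℝ × ℝ)) × (ℝ × (ℝ × ℝ))) :=
      (Cyl ρ ×ˢ Cyl ρ) ∩ ({p | ε' ≤ dist p.1 p.2} ∩ {p | ε' ≤ dist (cjq p.1) p.2}) with hS
    have hSc : IsCompact S := by
      apply ((Cyl_compact ρ).prod (Cyl_compact ρ)).inter_right
      apply IsClosed.inter
      · exact isClosed_le continuous_const (by fun_prop)
      · exact isClosed_le continuous_const (by fun_prop)
    have hcont : ContinuousOn (fun p : (ℝ × (ℝ × ℝ)) × (ℝ × (ℝ × ℝ)) => dist (c p.1) (c p.2)) S := by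
      exact continuous_dist.comp_continuousOn (ContinuousOn.prodMk
        (hc.cont.comp continuousOn_fst (fun p hp => hp.1.1))
        (hc.cont.comp continuousOn_snd (fun p hp => hp.1.2)))
    rcases S.eq_empty_or_nonempty with hE | hne
    · refine ⟨1, one_pos, fun q hq q' hq' _ => ?_⟩
      by_contra hn
      push Not at hn
      have : (q, q') ∈ S := ⟨⟨hq, hq'⟩, hn⟩
      rw [hE] at this
      exact this
    · obtain ⟨p, hp, hmin⟩ := hSc.exists_isMinOn hne hcont
      have hpos : 0 < dist (c p.1) (c p.2) := by
        rw [dist_pos]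
        intro he
        obtain ⟨h1, h2, h3⟩ := hc.inj _ hp.1.1 _ hp.1.2 he
        rcases h3 with h3 | ⟨_, h3⟩
        · have : p.1 = p.2 := Prod.ext h1 (Prod.ext h2 h3)
          have h4 : ε' ≤ dist p.1 p.2 := hp.2.1
          rw [this, dist_self] at h4
          linarith
        · have : cjq p.1 = p.2 := Prod.ext h1 (Prod.ext h2 (by simp [cjq, h3]))
          have h4 : ε' ≤ dist (cjq p.1) p.2 := hp.2.2
          rw [this, dist_self] at h4
          linarith
      refine ⟨dist (c p.1) (c p.2) / 2, by positivity, fun q hq q' hq' hd => ?_⟩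
      by_contra hn
      push Not at hn
      have : (q, q') ∈ S := ⟨⟨hq, hq'⟩, hn⟩
      have h5 := hmin this
      simp only [mem_ofPred_eq] at h5
      linarith
  obtain ⟨δ, hδ, hcl⟩ := claim
  refine ⟨δ, hδ, fun K hKc hKs hKl q hq q' hq' hqK hqK' => ?_⟩
  have d1 := hcl q hq q' hq' (hKs _ hqK _ hqK')
  by_cases hfar : dist q (cjq q) ≤ 2 * ε'
  · rcases d1 with h | h
    · linarith
    · have := dist_triangle q (cjq q) q'
      linarith
  · have cl : ∀ w, IsClosed (c '' (Cyl ρ ∩ Metric.closedBall w ε')) := fun w =>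
      (((Cyl_compact ρ).inter_right Metric.isClosed_closedBall).image_of_continuousOn
        (hc.cont.mono inter_subset_left)).isClosed
    have hcov : K ⊆ c '' (Cyl ρ ∩ Metric.closedBall q ε') ∪ c '' (Cyl ρ ∩ Metric.closedBall (cjq q) ε') := by
      intro x hx
      obtain ⟨w, hw, _, rfl⟩ := hKl x hx
      rcases hcl q hq w hw (hKs _ hqK _ hx) with h | h
      · left; exact ⟨w, ⟨hw, by rw [Metric.mem_closedBall, dist_comm]; exact h.le⟩, rfl⟩
      · right; exact ⟨w, ⟨hw, by rw [Metric.mem_closedBall, dist_comm]; exact h.le⟩, rfl⟩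
    rcases d1 with h | h
    · linarith
    · exfalso
      obtain ⟨x, hxK, ⟨w, ⟨hw, hwb⟩, rfl⟩, ⟨w', ⟨hw', hwb'⟩, he⟩⟩ :=
        isPreconnected_closed_iff.1 hKc _ _ (cl q) (cl (cjq q)) hcov
        ⟨c q, hqK, ⟨q, ⟨hq, Metric.mem_closedBall_self e0.le⟩, rfl⟩⟩
        ⟨c q', hqK', ⟨q', ⟨hq', by rw [Metric.mem_closedBall, dist_comm]; exact h.le⟩, rfl⟩⟩
      obtain ⟨v, hv, hv0, hve⟩ := hKl _ hxK
      have : w' = w := by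
        obtain ⟨h1, h2, h3⟩ := hc.inj _ hw' _ hw he
        rcases h3 with h3 | ⟨h3, _⟩
        · exact Prod.ext h1 (Prod.ext h2 h3)
        · have := (hc.inj _ hv _ hw hve).1
          linarith
      subst this
      rw [Metric.mem_closedBall, dist_comm] at hwb
      rw [Metric.mem_closedBall] at hwb'
      have := dist_triangle q w' (cjq q)
      linarith

lemma collar_shrink {c : ℝ × (ℝ × ℝ) → X} {ρ : ℝ} (hc : Collar c ρ) {V : Set X} (hV : IsOpen V)
    (haV : (fun u => c (0, u)) '' circS ⊆ V) : ∃ σ, 0 < σ ∧ σ ≤ ρ ∧ c '' (Icc 0 σ ×ˢ circS) ⊆ V := by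
  have h1 : IsClosed (Cyl ρ ∩ c ⁻¹' Vᶜ) :=
    hc.cont.preimage_isClosed_of_isClosed (Cyl_compact ρ).isClosed hV.isClosed_compl
  have h2 : IsCompact (Cyl ρ ∩ c ⁻¹' Vᶜ) := (Cyl_compact ρ).of_isClosed_subset h1 inter_subset_left
  rcases (Cyl ρ ∩ c ⁻¹' Vᶜ).eq_empty_or_nonempty with hE | hne
  · refine ⟨ρ, hc.pos, le_rfl, ?_⟩
    rintro x ⟨q, hq, rfl⟩
    by_contra hn
    have : q ∈ Cyl ρ ∩ c ⁻¹' Vᶜ := ⟨hq, hn⟩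
    rw [hE] at this
    exact this
  · obtain ⟨p, hp, hmin⟩ := h2.exists_isMinOn hne continuousOn_fst
    have hp0 : 0 < p.1 := by
      rcases hp.1.1.1.eq_or_lt with h | h
      · exact (hp.2 (haV ⟨p.2, hp.1.2, by simp only; congr 1; exact Prod.ext h rfl⟩)).elim
      · exact h
    refine ⟨p.1 / 2, by positivity, by linarith [hp.1.1.2], ?_⟩
    rintro x ⟨q, hq, rfl⟩
    by_contra hn
    have : q ∈ Cyl ρ ∩ c ⁻¹' Vᶜ := ⟨⟨⟨hq.1.1, by linarith [hp.1.1.2, hq.1.2]⟩, hq.2⟩, hn⟩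
    have h5 := hmin this
    simp only [mem_ofPred_eq] at h5
    linarith [hq.1.2]

end SecD

section SecE
lemma ellM_cont {f g : ℝ → ℝ} (cf : Continuous f) (cg : Continuous g) : Continuous (ellM f g) := by
  unfold ellM; fun_prop

lemma collar_prop {X : Type*} [MetricSpace X] {c : ℝ × (ℝ × ℝ) → X} {ρ : ℝ} (hc : Collar c ρ)
    {K : ℕ → Set X} {S : Set ℕ}
    (hK : ∀ l ∈ S, IsClosed (K l)) (disj : ∀ l ∈ S, Disjoint (K l) ((fun u => c (0, u)) '' circS))
    (contr : ∀ ε > 0, {l | l ∈ S ∧ ¬ SmS (K l) ε}.Finite)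
    (hac : IsCompact ((fun u => c (0, u)) '' circS)) {σ : ℝ} (h0 : 0 < σ) (hσ : σ ≤ ρ) :
    ∃ σ', 0 < σ' ∧ σ' < σ ∧ ∀ l ∈ S, ∀ x ∈ K l, x ∈ c '' (Icc 0 σ' ×ˢ circS) →
      K l ⊆ c '' (Ico 0 σ ×ˢ circS) := by
  have ho := hc.opn σ h0 hσ
  obtain ⟨δ, hδ, hsub⟩ := hac.exists_thickening_subset_open ho (by
    rintro _ ⟨u, hu, rfl⟩
    exact ⟨(0, u), ⟨⟨le_rfl, h0⟩, hu⟩, rfl⟩)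
  obtain ⟨δ', hδ', hav⟩ := avoid hac hK disj contr (ε := δ/2) (by positivity)
  have hm : 0 < min δ' (δ/2) := by positivity
  obtain ⟨s, s0, s1, s2⟩ := collar_shrink hc (Metric.isOpen_thickening (δ := min δ' (δ/2)))
    (Metric.self_subset_thickening hm _)
  refine ⟨min s (σ/2), by positivity, (min_le_right _ _).trans_lt (by linarith), ?_⟩
  rintro l hl x hx ⟨q, hq, rfl⟩ y hy
  have h1 := s2 ⟨q, ⟨⟨hq.1.1, hq.1.2.trans (min_le_left _ _)⟩, hq.2⟩, rfl⟩
  obtain ⟨z, hz, hd⟩ := Metric.mem_thickening_iff.1 h1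
  have h2 := hav l hl _ hx z hz (hd.trans_le (min_le_left _ _)) y hy _ hx
  apply hsub
  refine Metric.mem_thickening_iff.2 ⟨z, hz, ?_⟩
  have := dist_triangle y (c q) z
  have := min_le_right δ' (δ/2)
  linarith

lemma step {X : Type*} [MetricSpace X] {c : ℝ × (ℝ × ℝ) → X} {ρ : ℝ} (hc : Collar c ρ)
    {K : ℕ → Set X} {S : Set ℕ} {a : Set X} (ha : a = (fun u => c (0, u)) '' circS)
    (hK : ∀ l ∈ S, IsClosed (K l)) (hKp : ∀ l ∈ S, IsPreconnected (K l))
    (disj : ∀ l ∈ S, Disjoint (K l) a)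
    (contr : ∀ ε > 0, {l | l ∈ S ∧ ¬ SmS (K l) ε}.Finite) {η : ℝ} (hη : 0 < η) :
    ∃ (φ : X → X) (b : ℝ × ℝ → X) (T : Set X) (θ : ℝ), 0 < θ ∧ θ ≤ η ∧
      (∀ x, x ∉ T → φ x = x) ∧ (∀ x, x ∈ T → φ x ∈ T) ∧ (∀ x ∈ T, ∃ q ∈ a, dist x q < θ) ∧
      (∀ l ∈ S, ∀ p ∈ K l, ∀ q ∈ a, dist p q < 3 * θ → SmS (φ '' K l) η) ∧
      (∀ ε > 0, {l | l ∈ S ∧ ¬ SmS (φ '' K l) ε}.Finite) ∧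
      ContinuousOn φ aᶜ ∧ BijOn φ aᶜ (b '' circS)ᶜ ∧
      (∀ U, IsOpen U → U ⊆ aᶜ → IsOpen (φ '' U)) ∧ (b '' circS ⊆ T) ∧ ContinuousOn b circS ∧
      (∀ p ∈ circS, ∀ q ∈ circS, (b p = b q ↔ (p.1 = q.1 ∨ p.1 = -q.1) ∧ p.2 = q.2)) ∧
      (∀ p ∈ circS, Tendsto (fun q => φ (c q)) (𝓝[Ioc 0 ρ ×ˢ circS] ((0:ℝ), p)) (𝓝 (b p))) := by
  subst ha
  set a := (fun u => c (0, u)) '' circS with ha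
  have ρ0 := hc.pos
  have ρ1 := hc.le_one
  have h0C : ∀ u ∈ circS, ((0:ℝ), u) ∈ Cyl ρ := fun u hu => ⟨⟨le_rfl, hc.pos.le⟩, hu⟩
  have hac : IsCompact a := by
    apply circS_compact.image_of_continuousOn
    exact hc.cont.comp (by fun_prop) h0C
  obtain ⟨e, ec, ei, eq⟩ := exists_chart hc
  have hf1 : StrictMono (fun s : ℝ => 1 + s) := fun a b h => by simp only; linarith
  have hg1 : StrictMono (fun s : ℝ => s) := fun a b h => h
  have hEc : IsCompact (ellD (1+ρ) ρ) := by
    have : ellD (1+ρ) ρ = ellM (fun s : ℝ => 1 + s) (fun s => s) '' Cyl ρ := by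
      apply Subset.antisymm
      · intro w hw
        exact ell_surj' hf1 hg1 (by fun_prop) (by fun_prop) (by norm_num) rfl hc.pos hw
      · rintro _ ⟨q, hq, rfl⟩
        exact ellM_mem hf1 hg1 (by norm_num) le_rfl hq
    rw [this]
    exact (Cyl_compact ρ).image (ellM_cont (by fun_prop) (by fun_prop))
  obtain ⟨ε1, e1p, e1⟩ := Metric.uniformContinuousOn_iff.1 (hEc.uniformContinuousOn_of_continuous ec) η hη
  obtain ⟨δ1, d1p, d1⟩ := avoid hac hK disj contr hη
  set θ := min η (δ1/3) with hθ
  have θ0 : 0 < θ := by positivity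
  obtain ⟨δ2, d2p, d2⟩ := lift_small hc (ε := ε1/16) (by positivity)
  obtain ⟨δ3, d3p, d3⟩ := avoid hac hK disj contr d2p
  have hP := fun σ h0 hσ => collar_prop hc hK disj contr hac (σ := σ) h0 hσ
  have hm : 0 < min θ δ3 := by positivity
  obtain ⟨r1, r1p, r1ρ, r1s⟩ := collar_shrink hc (Metric.isOpen_thickening (δ := min θ δ3))
    (Metric.self_subset_thickening hm _)
  set r0 := min r1 (min (ρ/2) (ε1/16)) with hr0
  have r0p : 0 < r0 := by positivity
  have r0a : r0 ≤ r1 := min_le_left _ _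
  have r0b : r0 ≤ ρ/2 := (min_le_right _ _).trans (min_le_left _ _)
  have r0c : r0 ≤ ε1/16 := (min_le_right _ _).trans (min_le_right _ _)
  obtain ⟨r, rp, rr0, hr⟩ := hP r0 r0p (by linarith)
  have lift : ∀ l ∈ S, ∀ x ∈ K l, x ∈ c '' (Icc 0 ρ ×ˢ circS) → ∃ q ∈ Cyl ρ, 0 < q.1 ∧ c q = x := by
    rintro l hl x hx ⟨q, hq, rfl⟩
    refine ⟨q, hq, ?_, rfl⟩
    rcases hq.1.1.eq_or_lt with h | h
    · exfalso
      apply (disj l hl).le_bot ⟨hx, ?_⟩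
      exact ⟨q.2, hq.2, by simp only; congr 1; exact Prod.ext h rfl⟩
    · exact h
  have hlt : ∀ σ, σ ≤ ρ → ∀ q ∈ Cyl ρ, c q ∈ c '' (Ico 0 σ ×ˢ circS) → q.1 < σ := by
    rintro σ hσ q hq ⟨q', hq', he⟩
    have := (hc.inj _ ⟨⟨hq'.1.1, hq'.1.2.le.trans hσ⟩, hq'.2⟩ _ hq he).1
    rw [← this]; exact hq'.1.2
  set 𝒦 : Set (Set ℝ) := {J | ∃ l ∈ S, J = {s | 0 < s ∧ s ≤ ρ ∧ ∃ u ∈ circS, c (s, u) ∈ K l}} with h𝒦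
  have hP𝒦 : ∀ σ σ', σ ≤ ρ → (∀ l ∈ S, ∀ x ∈ K l, x ∈ c '' (Icc 0 σ' ×ˢ circS) →
      K l ⊆ c '' (Ico 0 σ ×ˢ circS)) → ∀ J ∈ 𝒦, (∃ s ∈ J, s ≤ σ') → ∀ s ∈ J, s < σ := by
    rintro σ σ' hσ hh J ⟨l, hl, rfl⟩ ⟨s, ⟨s0, s1, u, hu, hx⟩, hs⟩ s' ⟨t0, t1, u', hu', hx'⟩
    have := hh l hl _ hx ⟨(s, u), ⟨⟨s0.le, hs⟩, hu⟩, rfl⟩ hx'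
    exact hlt σ hσ (s', u') ⟨⟨t0.le, t1⟩, hu'⟩ this
  obtain ⟨f, f1, f2, f3, f4, f5⟩ := osc_fun2 (𝒦 := 𝒦) (ρ := ρ) hc.le_one (by
      intro σ h0 hσ
      obtain ⟨σ', a1, a2, a3⟩ := hP σ h0 hσ
      exact ⟨σ', a1, a2, hP𝒦 σ σ' hσ a3⟩) (by
      rintro J ⟨l, hl, rfl⟩ s hs
      exact hs.1) (ε := ε1/16) (by positivity) rp rr0 (by linarith) (hP𝒦 r0 r (by linarith) hr)
  set g : ℝ → ℝ := fun s => max s ((r+s)/2) with hg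
  have g1 : StrictMono g := by
    intro x y hxy
    simp only [hg]
    exact max_lt_max hxy (by linarith)
  have g2 : Continuous g := by fun_prop
  have g0 : 0 < g 0 := by simp only [hg]; exact lt_max_of_lt_right (by linarith)
  have g4 : ∀ s, r ≤ s → g s = s := fun s hs => max_eq_left (by linarith)
  have gr0 : ∀ s, s < r0 → g s < r0 := fun s hs => max_lt hs (by linarith)
  have fρ : f ρ = 1 + ρ := f4 ρ (by linarith)
  have gρ : g ρ = ρ := g4 ρ (by linarith)
  have hmem : ∀ q ∈ Cyl ρ, ellM f g q ∈ ellD (1+ρ) ρ := by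
    intro q hq
    have := ellM_mem f1 g1 f3.ge g0.le hq
    rwa [fρ, gρ] at this
  have Gc : ContinuousOn (fun q => e (ellM f g q)) (Cyl ρ) :=
    ec.comp (ellM_cont f2 g2).continuousOn hmem
  obtain ⟨φ, p1, p2, p3, p4, p5, p6, p7⟩ := swap_map (c := c) (G := fun q => e (ellM f g q)) hc rp
    (show r < ρ by linarith) Gc (by
      intro q hq q' hq' he
      have := ei (hmem q hq) (hmem q' hq') he
      simp only [ellM, Prod.mk.injEq] at this
      exact ell_fiber f1 g1 f3 g0 hq.1.1 hq'.1.1 hq.2 hq'.2 this.1 this.2) (by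
      apply Subset.antisymm
      · rintro _ ⟨q, hq, rfl⟩
        obtain ⟨q', hq', he⟩ := ell_surj' hf1 hg1 (by fun_prop) (by fun_prop) (by norm_num) rfl hc.pos (hmem q hq)
        refine ⟨q', hq', ?_⟩
        simp only [← he, eq q' hq']
      · rintro _ ⟨q, hq, rfl⟩
        have h1 : ellM (fun s => 1 + s) (fun s => s) q ∈ ellD (f ρ) (g ρ) := by
          rw [fρ, gρ]; exact ellM_mem hf1 hg1 (by norm_num) le_rfl hq
        obtain ⟨q', hq', he⟩ := ell_surj f1 g1 f2 g2 f3 g0 hc.pos h1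
        refine ⟨q', hq', ?_⟩
        simp only [he, eq q hq]) (by
      intro q hq hs
      simp only [← eq q hq, ellM, f4 _ hs, g4 _ hs])
  set T := c '' (Ico 0 r ×ˢ circS) with hT
  have hTn : ∀ x ∈ T, ∃ q ∈ a, dist x q < min θ δ3 := by
    rintro _ ⟨q, hq, rfl⟩
    exact Metric.mem_thickening_iff.1 (r1s ⟨q, ⟨⟨hq.1.1, by have := hq.1.2; linarith⟩, hq.2⟩, rfl⟩)
  have hTK : ∀ l ∈ S, (∃ x ∈ K l, x ∈ T) → K l ⊆ c '' (Ico 0 r0 ×ˢ circS) := by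
    rintro l hl ⟨x, hx, ⟨q, hq, rfl⟩⟩
    exact hr l hl _ hx ⟨q, ⟨⟨hq.1.1, hq.1.2.le⟩, hq.2⟩, rfl⟩
  have hTK' : ∀ l ∈ S, (∃ x ∈ K l, x ∈ T) → ∀ x ∈ K l, ∃ q ∈ Cyl ρ, 0 < q.1 ∧ c q = x := by
    intro l hl h x hx
    obtain ⟨q, hq, he⟩ := hTK l hl h hx
    exact lift l hl x hx ⟨q, ⟨⟨hq.1.1, by have := hq.1.2; linarith⟩, hq.2⟩, he⟩
  have hnot : ∀ l, ¬ (∃ x ∈ K l, x ∈ T) → φ '' K l = K l := by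
    intro l h
    push Not at h
    have : ∀ x ∈ K l, φ x = id x := fun x hx => p2 x (h x hx)
    rw [image_congr this, image_id]
  have key : ∀ l ∈ S, (∃ x ∈ K l, x ∈ T) → SmS (φ '' K l) η := by
    rintro l hl hx
    have hlf := hTK' l hl hx
    have hsub := hTK l hl hx
    obtain ⟨x0, hx0, hx0T⟩ := hx
    obtain ⟨z, hz, hd⟩ := hTn x0 hx0T
    have hsm := d3 l hl x0 hx0 z hz (hd.trans_le (min_le_right _ _))
    have hD := d2 (K l) (hKp l hl) hsm hlf
    rintro _ ⟨x, hx, rfl⟩ _ ⟨y, hy, rfl⟩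
    obtain ⟨⟨s, u⟩, hq, q0, rfl⟩ := hlf x hx
    obtain ⟨⟨s', u'⟩, hq', q0', rfl⟩ := hlf y hy
    obtain ⟨⟨t, v⟩, hqt, t0, he⟩ := hlf x0 hx0
    rw [← he] at hx0T hx0
    have htr := hlt r (by linarith) _ hqt hx0T
    have hs := hlt r0 (by linarith) _ hq (hsub hx)
    have hs' := hlt r0 (by linarith) _ hq' (hsub hy)
    rw [p1 _ hq q0, p1 _ hq' q0']
    refine (e1 _ (hmem _ hq) _ (hmem _ hq') ?_).le
    have hdd := hD _ hq _ hq' hx hy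
    have hff := f5 _ ⟨l, hl, rfl⟩ ⟨t, ⟨t0, hqt.1.2, v, hqt.2, hx0⟩, htr.le⟩ s ⟨q0, hq.1.2, u, hq.2, hx⟩
      s' ⟨q0', hq'.1.2, u', hq'.2, hy⟩
    simp only [Prod.dist_eq, max_le_iff, Real.dist_eq] at hdd
    simp only at q0 q0' hs hs'
    have hu := circS_abs hq.2
    have hu' := circS_abs hq'.2
    simp only at hu hu'
    have gs := gr0 s hs
    have gs' := gr0 s' hs'
    have gp : 0 < g s := g0.trans (g1 q0)
    have gp' : 0 < g s' := g0.trans (g1 q0')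
    have fp' : 0 ≤ f s' := by rw [← f3]; exact f1.monotone q0'.le
    have fle : f s' ≤ 2 := by
      have := f1.monotone hq'.1.2
      rw [fρ] at this
      simp only at this
      linarith
    rw [Prod.dist_eq, max_lt_iff, Real.dist_eq, Real.dist_eq]
    simp only [ellM]
    constructor
    · have e1 : f s * u.1 - f s' * u'.1 = (f s - f s') * u.1 + f s' * (u.1 - u'.1) := by ring
      rw [e1]
      have a1 : |(f s - f s') * u.1| ≤ ε1/16 + r0 := by
        rw [abs_mul]
        calc _ ≤ |f s - f s'| * 1 := mul_le_mul_of_nonneg_left hu.1 (abs_nonneg _)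
          _ ≤ _ := by linarith
      have a2 : |f s' * (u.1 - u'.1)| ≤ 2 * (ε1/16) := by
        rw [abs_mul, abs_of_nonneg fp']
        exact mul_le_mul fle hdd.2.1 (abs_nonneg _) (by norm_num)
      have := abs_add_le ((f s - f s') * u.1) (f s' * (u.1 - u'.1))
      linarith
    · have a1 : |g s * u.2| ≤ r0 := by
        rw [abs_mul, abs_of_pos gp]
        calc _ ≤ g s * 1 := mul_le_mul_of_nonneg_left hu.2 gp.le
          _ ≤ _ := by linarith
      have a2 : |g s' * u'.2| ≤ r0 := by
        rw [abs_mul, abs_of_pos gp']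
        calc _ ≤ g s' * 1 := mul_le_mul_of_nonneg_left hu'.2 gp'.le
          _ ≤ _ := by linarith
      have := abs_sub (g s * u.2) (g s' * u'.2)
      linarith
  refine ⟨φ, fun u => e (ellM f g (0, u)), T, θ, θ0, min_le_left _ _, p2, p3, ?_, ?_, ?_, p5, p6, p7,
    ?_, ?_, ?_, ?_⟩
  · intro x hx
    obtain ⟨q, hq, hd⟩ := hTn x hx
    exact ⟨q, hq, hd.trans_le (min_le_left _ _)⟩
  · intro l hl p hp q hq hd
    by_cases hx : ∃ x ∈ K l, x ∈ T
    · exact key l hl hx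
    · rw [hnot l hx]
      refine d1 l hl p hp q hq (hd.trans_le ?_)
      have := min_le_right η (δ1/3)
      linarith
  · intro ε hε
    obtain ⟨ε', ep, hue⟩ := Metric.uniformContinuousOn_iff.1
      ((Cyl_compact ρ).uniformContinuousOn_of_continuous Gc) ε hε
    obtain ⟨δ5, d5p, d5⟩ := lift_small hc (ε := ε'/2) (by positivity)
    refine (contr (min ε δ5) (by positivity)).subset ?_
    rintro l ⟨hl, hn⟩
    refine ⟨hl, fun hsm => hn ?_⟩
    by_cases hx : ∃ x ∈ K l, x ∈ T
    · have hlf := hTK' l hl hx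
      have hD := d5 (K l) (hKp l hl) (fun x hx y hy => (hsm x hx y hy).trans (min_le_right _ _)) hlf
      rintro _ ⟨x, hx, rfl⟩ _ ⟨y, hy, rfl⟩
      obtain ⟨q, hq, q0, rfl⟩ := hlf x hx
      obtain ⟨q', hq', q0', rfl⟩ := hlf y hy
      rw [p1 _ hq q0, p1 _ hq' q0']
      exact (hue _ hq _ hq' ((hD q hq q' hq' hx hy).trans_lt (by linarith))).le
    · rw [hnot l hx]
      exact fun x hx y hy => (hsm x hx y hy).trans (min_le_left _ _)
  · rintro _ ⟨u, hu, rfl⟩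
    exact p4 u hu
  · exact Gc.comp (by fun_prop) h0C
  · intro p hp q hq
    constructor
    · intro he
      have := ei (hmem _ (h0C p hp)) (hmem _ (h0C q hq)) he
      simp only [ellM, Prod.mk.injEq] at this
      have h2 := mul_left_cancel₀ g0.ne' this.2
      refine ⟨?_, h2⟩
      exact sq_circ (swap_circ hp) (swap_circ hq) h2
    · rintro ⟨_, h2⟩
      simp only [ellM, f3, h2, zero_mul]
  · intro p hp
    have h1 : Tendsto (fun q => e (ellM f g q)) (𝓝[Ioc 0 ρ ×ˢ circS] ((0:ℝ), p))
        (𝓝 (e (ellM f g (0, p)))) :=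
      (Gc _ (h0C p hp)).mono_left (nhdsWithin_mono _ (prod_mono Ioc_subset_Icc_self le_rfl))
    refine h1.congr' ?_
    filter_upwards [self_mem_nhdsWithin] with q hq
    exact (p1 q ⟨Ioc_subset_Icc_self hq.1, hq.2⟩ hq.1.1).symm

end SecE

section SecF
lemma collar_comp {X : Type*} [MetricSpace X] {c : ℝ × (ℝ × ℝ) → X} {ρ : ℝ} (hc : Collar c ρ)
    {O : Set X} (hO : IsOpen O) {Φ : X → X} (hΦ : ContinuousOn Φ O) (hi : InjOn Φ O)
    (ho : ∀ U, IsOpen U → U ⊆ O → IsOpen (Φ '' U))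
    (haO : (fun u => c (0, u)) '' circS ⊆ O) :
    ∃ ρ', ρ' ≤ ρ ∧ Collar (fun q => Φ (c q)) ρ' := by
  obtain ⟨σ, s0, s1, s2⟩ := collar_shrink hc hO haO
  have hsub : ∀ q ∈ Cyl σ, q ∈ Cyl ρ := fun q hq => ⟨⟨hq.1.1, hq.1.2.trans s1⟩, hq.2⟩
  have hcO : ∀ q ∈ Cyl σ, c q ∈ O := fun q hq => s2 ⟨q, hq, rfl⟩
  refine ⟨σ, s1, s0, s1.trans hc.le_one, ?_, ?_, ?_, ?_⟩
  · exact hΦ.comp (hc.cont.mono hsub) hcO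
  · intro q hq q' hq' he
    exact hc.inj q (hsub q hq) q' (hsub q' hq') (hi (hcO q hq) (hcO q' hq') he)
  · intro u hu
    simp only [hc.glue u hu]
  · intro r hr hrσ
    have : (fun q => Φ (c q)) '' (Ico 0 r ×ˢ circS) = Φ '' (c '' (Ico 0 r ×ˢ circS)) := by
      rw [image_image]
    rw [this]
    apply ho _ (hc.opn r hr (hrσ.trans s1))
    rintro _ ⟨q, hq, rfl⟩
    exact hcO q ⟨⟨hq.1.1, hq.1.2.le.trans hrσ⟩, hq.2⟩

def OO {X : Type*} (a : ℕ → Set X) (k : ℕ) : Set X := (⋃ n ∈ {n | n < k}, a n)ᶜ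

lemma mem_OO {X : Type*} {a : ℕ → Set X} {k : ℕ} {x : X} : x ∈ OO a k ↔ ∀ n < k, x ∉ a n := by
  simp [OO]

lemma OO_succ {X : Type*} {a : ℕ → Set X} {k : ℕ} {x : X} :
    x ∈ OO a (k+1) ↔ x ∈ OO a k ∧ x ∉ a k := by
  simp only [mem_OO]
  constructor
  · intro h; exact ⟨fun n hn => h n (by omega), h k (by omega)⟩
  · rintro ⟨h1, h2⟩ n hn
    rcases Nat.lt_succ_iff_lt_or_eq.1 hn with h | rfl
    · exact h1 n h
    · exact h2

structure StInv {X : Type*} [MetricSpace X] (a : ℕ → Set X) (k : ℕ) (Φ : X → X) (B : Set X) : Prop where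
  bij : BijOn Φ (OO a k) Bᶜ
  cont : ContinuousOn Φ (OO a k)
  opn : ∀ U, IsOpen U → U ⊆ OO a k → IsOpen (Φ '' U)
  contr : ∀ ε > 0, {l | k ≤ l ∧ ¬ SmS (Φ '' a l) ε}.Finite

structure Arcs {X : Type*} [MetricSpace X] (I : Set ℕ) (c : ℕ → ℝ × (ℝ × ℝ) → X)
    (a : ℕ → Set X) : Prop where
  col : ∀ n ∈ I, Collar (c n) 1
  arc : ∀ n ∈ I, a n = (fun u => c n (0, u)) '' circS
  emp : ∀ n, n ∉ I → a n = ∅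
  disj : ∀ m n, m ≠ n → Disjoint (a m) (a n)
  contr : ∀ ε > 0, {l | ¬ SmS (a l) ε}.Finite

structure StepOut {X : Type*} [MetricSpace X] (I : Set ℕ) (c : ℕ → ℝ × (ℝ × ℝ) → X)
    (a : ℕ → Set X) (k : ℕ) (Φ : X → X) (B : Set X) (τ : ℝ)
    (φ : X → X) (b : ℝ × ℝ → X) (T C : Set X) (η θ D : ℝ) : Prop where
  η_le : η ≤ τ
  θ_pos : 0 < θ
  θ_le : θ ≤ η
  D_le : 100 * η ≤ D
  T_out : ∀ x, x ∉ T → φ x = x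
  T_in : ∀ x, x ∈ T → φ x ∈ T
  T_sub : ∀ x, x ∈ T → ∃ q ∈ Φ '' a k, dist x q < θ
  near : ∀ l, k < l → ∀ p ∈ Φ '' a l, ∀ q ∈ Φ '' a k, dist p q < 3 * θ → SmS (φ '' (Φ '' a l)) η
  sep : ∀ l, k < l → ¬ SmS (Φ '' a l) (D / 100) → ∀ p ∈ Φ '' a l, ∀ q ∈ Φ '' a k, 100 * η ≤ dist p q
  V_in : ∀ x ∈ OO a k, ∀ q ∈ Φ '' a k, dist (Φ x) q < D → ∃ q ∈ a k, dist x q < 1 / (k + 1 : ℝ)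
  V_B : ∀ y ∈ B, ∀ q ∈ Φ '' a k, D ≤ dist y q
  C_T : C ⊆ T
  C_in : k ∈ I → C = b '' circS
  C_out : k ∉ I → C = ∅
  b_cont : k ∈ I → ContinuousOn b circS
  b_iff : k ∈ I → ∀ p ∈ circS, ∀ q ∈ circS, (b p = b q ↔ (p.1 = q.1 ∨ p.1 = -q.1) ∧ p.2 = q.2)
  tend : k ∈ I → ∀ p ∈ circS, Tendsto (fun q => φ (Φ (c k q))) (𝓝[Ioc 0 1 ×ˢ circS] ((0:ℝ), p)) (𝓝 (b p))
  inv : StInv a (k+1) (φ ∘ Φ) (B ∪ C)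

section
variable {X : Type*} [MetricSpace X] {I : Set ℕ} {c : ℕ → ℝ × (ℝ × ℝ) → X} {a : ℕ → Set X}

lemma Arcs.compact (h : Arcs I c a) (n : ℕ) : IsCompact (a n) := by
  by_cases hn : n ∈ I
  · rw [h.arc n hn]
    apply circS_compact.image_of_continuousOn
    exact (h.col n hn).cont.comp (by fun_prop) (fun u hu => ⟨⟨le_rfl, zero_le_one⟩, hu⟩)
  · rw [h.emp n hn]; exact isCompact_empty

lemma Arcs.preconn (h : Arcs I c a) (n : ℕ) : IsPreconnected (a n) := by
  by_cases hn : n ∈ I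
  · rw [h.arc n hn]
    apply circS_preconn.image
    exact (h.col n hn).cont.comp (by fun_prop) (fun u hu => ⟨⟨le_rfl, zero_le_one⟩, hu⟩)
  · rw [h.emp n hn]; exact isPreconnected_empty

lemma Arcs.open_OO (h : Arcs I c a) (k : ℕ) : IsOpen (OO a k) := by
  unfold OO
  exact ((finite_lt_nat k).isClosed_biUnion (fun n _ => (h.compact n).isClosed)).isOpen_compl

lemma Arcs.sub_OO (h : Arcs I c a) {k l : ℕ} (hkl : k ≤ l) : a l ⊆ OO a k := by
  intro x hx
  rw [mem_OO]
  intro n hn hx'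
  exact (h.disj n l (by omega)).le_bot ⟨hx', hx⟩

lemma step_out (h : Arcs I c a) {k : ℕ} {Φ : X → X} {B : Set X} (hI : StInv a k Φ B) {τ : ℝ} (hτ : 0 < τ) :
    ∃ (φ : X → X) (b : ℝ × ℝ → X) (T C : Set X) (η θ D : ℝ),
      StepOut I c a k Φ B τ φ b T C η θ D := by
  by_cases hk : k ∈ I
  swap
  · have hE := h.emp k hk
    have hO : OO a (k+1) = OO a k := by
      ext x; rw [OO_succ, hE]; simp
    refine ⟨id, fun _ => Φ (c k 0), ∅, ∅, τ, τ, 100 * τ, le_rfl, hτ, le_rfl, le_rfl, by simp, by simp,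
      by simp, by simp [hE], by simp [hE], by simp [hE], by simp [hE], by simp,
      fun hh => (hk hh).elim, by simp, fun hh => (hk hh).elim, fun hh => (hk hh).elim,
      fun hh => (hk hh).elim, ?_⟩
    rw [union_empty, Function.id_comp]
    refine ⟨by rw [hO]; exact hI.bij, by rw [hO]; exact hI.cont, by rw [hO]; exact hI.opn, ?_⟩
    intro ε hε
    exact (hI.contr ε hε).subset (fun l hl => ⟨by have := hl.1; omega, hl.2⟩)
  have hakO : a k ⊆ OO a k := h.sub_OO le_rfl
  have hOo := h.open_OO k
  obtain ⟨ρ, hρ1, hcol⟩ := collar_comp (h.col k hk) hOo hI.cont hI.bij.injOn hI.opn (by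
    rw [← h.arc k hk]; exact hakO)
  have harc : Φ '' a k = (fun u => Φ (c k (0, u))) '' circS := by
    rw [h.arc k hk, image_image]
  have hKc : ∀ l, k ≤ l → IsCompact (Φ '' a l) := fun l hl =>
    (h.compact l).image_of_continuousOn (hI.cont.mono (h.sub_OO hl))
  have hKp : ∀ l, k ≤ l → IsPreconnected (Φ '' a l) := fun l hl =>
    (h.preconn l).image _ (hI.cont.mono (h.sub_OO hl))
  have hdis : ∀ l, k < l → Disjoint (Φ '' a l) (Φ '' a k) := by
    intro l hl
    rw [disjoint_left]
    rintro _ ⟨x, hx, rfl⟩ ⟨y, hy, he⟩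
    have := hI.bij.injOn (h.sub_OO le_rfl hy) (h.sub_OO hl.le hx) he
    exact (h.disj l k (by omega)).le_bot ⟨hx, this ▸ hy⟩
  have hcon : ∀ ε > 0, {l | l ∈ {l | k < l} ∧ ¬ SmS (Φ '' a l) ε}.Finite := fun ε hε =>
    (hI.contr ε hε).subset (fun l hl => ⟨le_of_lt hl.1, hl.2⟩)
  set W := OO a k ∩ Metric.thickening (1 / (k + 1 : ℝ)) (a k) with hW
  have hWo : IsOpen (Φ '' W) := hI.opn _ (hOo.inter Metric.isOpen_thickening) inter_subset_left
  obtain ⟨D, D0, hD⟩ := (hKc k le_rfl).exists_thickening_subset_open hWo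
    (image_mono (subset_inter hakO (Metric.self_subset_thickening (by positivity) _)))
  obtain ⟨δ, δ0, hδ⟩ := avoid (hKc k le_rfl) (S := {l | k < l}) (fun l hl => (hKc l (le_of_lt hl)).isClosed)
    hdis hcon (ε := D/100) (by positivity)
  set η := min τ (min (D/100) (δ/100)) with hη
  have η0 : 0 < η := by positivity
  have ηD : η ≤ D/100 := (min_le_right _ _).trans (min_le_left _ _)
  have ηδ : η ≤ δ/100 := (min_le_right _ _).trans (min_le_right _ _)
  obtain ⟨φ, b, T, θ, θ0, θη, T_out, T_in, T_sub, near, ncon, φc, φb, φo, bT, bc, bi, bt⟩ :=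
    step hcol harc (S := {l | k < l}) (fun l hl => (hKc l (le_of_lt hl)).isClosed)
      (fun l hl => hKp l (le_of_lt hl)) hdis hcon η0
  have V_B : ∀ y ∈ B, ∀ q ∈ Φ '' a k, D ≤ dist y q := by
    intro y hy q hq
    by_contra hn
    push Not at hn
    obtain ⟨x, hx, rfl⟩ := hD (Metric.mem_thickening_iff.2 ⟨q, hq, hn⟩)
    exact hI.bij.mapsTo hx.1 hy
  have TB : ∀ y ∈ B, φ y = y := by
    intro y hy
    apply T_out
    intro hT
    obtain ⟨q, hq, hd⟩ := T_sub y hT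
    have := V_B y hy q hq
    linarith
  have Bak : ∀ y ∈ B, y ∈ (Φ '' a k)ᶜ := by
    rintro y hy ⟨x, hx, rfl⟩
    exact hI.bij.mapsTo (hakO hx) hy
  have hO' : ∀ x, x ∈ OO a (k+1) → Φ x ∈ (Φ '' a k)ᶜ := by
    rintro x hx ⟨y, hy, he⟩
    rw [OO_succ] at hx
    have := hI.bij.injOn (hakO hy) hx.1 he
    exact hx.2 (this ▸ hy)
  have hOs : OO a (k+1) ⊆ OO a k := fun x hx => (OO_succ.1 hx).1
  refine ⟨φ, b, T, b '' circS, η, θ, D, min_le_left _ _, θ0, θη, by linarith, T_out, T_in, T_sub,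
    near, ?_, ?_, V_B, bT, fun _ => rfl, fun hh => (hh hk).elim, fun _ => bc, fun _ => bi, ?_, ?_⟩
  · intro l hl hns p hp q hq
    by_contra hn
    push Not at hn
    exact hns (hδ l hl p hp q hq (by linarith))
  · intro x hx q hq hd
    obtain ⟨x', hx', he⟩ := hD (Metric.mem_thickening_iff.2 ⟨q, hq, hd⟩)
    have := hI.bij.injOn hx'.1 hx he
    rw [← this]
    exact Metric.mem_thickening_iff.1 hx'.2
  · intro _ p hp
    refine (bt p hp).mono_left ?_
    refine le_of_eq ?_
    have hn : {q : ℝ × (ℝ × ℝ) | q.1 < ρ} ∈ 𝓝 ((0:ℝ), p) :=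
      (isOpen_lt continuous_fst continuous_const).mem_nhds hcol.pos
    rw [nhdsWithin_eq_nhdsWithin' hn]
    ext q
    simp only [mem_inter_iff, mem_prod, mem_Ioc, mem_ofPred_eq]
    constructor
    · rintro ⟨⟨⟨h1, h2⟩, h3⟩, h4⟩
      exact ⟨⟨⟨h1, h4.le⟩, h3⟩, h4⟩
    · rintro ⟨⟨⟨h1, h2⟩, h3⟩, h4⟩
      exact ⟨⟨⟨h1, h2.trans hρ1⟩, h3⟩, h4⟩
  · refine ⟨⟨?_, ?_, ?_⟩, ?_, ?_, ?_⟩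
    · intro x hx
      simp only [Function.comp, compl_union]
      refine ⟨fun hB => ?_, φb.mapsTo (hO' x hx)⟩
      have h1 := φb.injOn (Bak _ hB) (hO' x hx) (TB _ hB)
      rw [h1] at hB
      exact hI.bij.mapsTo (hOs hx) hB
    · intro x hx y hy he
      exact hI.bij.injOn (hOs hx) (hOs hy) (φb.injOn (hO' x hx) (hO' y hy) he)
    · rintro z hz
      rw [compl_union] at hz
      obtain ⟨y, hy, rfl⟩ := φb.surjOn hz.2
      have hyB : y ∈ Bᶜ := fun hyB => hz.1 (by rw [TB y hyB]; exact hyB)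
      obtain ⟨x, hx, rfl⟩ := hI.bij.surjOn hyB
      exact ⟨x, OO_succ.2 ⟨hx, fun hxa => hy ⟨x, hxa, rfl⟩⟩, rfl⟩
    · exact φc.comp (hI.cont.mono hOs) hO'
    · intro U hU hUO
      rw [image_comp]
      apply φo _ (hI.opn U hU (hUO.trans hOs))
      rintro _ ⟨x, hx, rfl⟩
      exact hO' x (hUO hx)
    · intro ε hε
      refine (ncon ε hε).subset ?_
      rintro l ⟨h1, h2⟩
      rw [image_comp] at h2
      exact ⟨h1, h2⟩

lemma exists_tower (h : Arcs I c a) : ∃ (Φ : ℕ → X → X) (B : ℕ → Set X) (τ : ℕ → ℝ) (φ : ℕ → X → X)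
    (b : ℕ → ℝ × ℝ → X) (T C : ℕ → Set X) (η θ D : ℕ → ℝ),
    Φ 0 = id ∧ B 0 = ∅ ∧ τ 0 = 1 ∧ (∀ k, Φ (k+1) = φ k ∘ Φ k) ∧ (∀ k, B (k+1) = B k ∪ C k) ∧
    (∀ k, τ (k+1) = θ k / 10) ∧ (∀ k, StInv a k (Φ k) (B k)) ∧
    ∀ k, StepOut I c a k (Φ k) (B k) (τ k) (φ k) (b k) (T k) (C k) (η k) (θ k) (D k) := by
  let St : ℕ → Type _ := fun k => {p : (X → X) × Set X × ℝ // StInv a k p.1 p.2.1 ∧ 0 < p.2.2}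
  have hst : ∀ k, ∀ p : St k, ∃ (φ : X → X) (b : ℝ × ℝ → X) (T C : Set X) (η θ D : ℝ),
      StepOut I c a k p.1.1 p.1.2.1 p.1.2.2 φ b T C η θ D := fun k p => step_out h p.2.1 p.2.2
  choose φ b T C η θ D hS using hst
  have h0 : StInv a 0 id (∅ : Set X) := by
    have hO : OO a 0 = univ := by ext x; simp [mem_OO]
    refine ⟨?_, ?_, ?_, ?_⟩
    · rw [hO, compl_empty]; exact bijOn_id _
    · exact continuousOn_id
    · intro U hU _; rw [image_id]; exact hU
    · intro ε hε
      simpa using h.contr ε hε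
  let sq : ∀ k, St k := fun k => Nat.rec (motive := St) ⟨(id, ∅, 1), h0, one_pos⟩
    (fun k p => ⟨(φ k p ∘ p.1.1, p.1.2.1 ∪ C k p, θ k p / 10), (hS k p).inv, by
      have := (hS k p).θ_pos
      simp only; positivity⟩) k
  refine ⟨fun k => (sq k).1.1, fun k => (sq k).1.2.1, fun k => (sq k).1.2.2, fun k => φ k (sq k),
    fun k => b k (sq k), fun k => T k (sq k), fun k => C k (sq k), fun k => η k (sq k),
    fun k => θ k (sq k), fun k => D k (sq k), rfl, rfl, rfl, fun k => rfl, fun k => rfl, fun k => rfl,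
    fun k => (sq k).2.1, fun k => hS k (sq k)⟩

end

end SecF

section SecG
section
variable {X : Type*} [MetricSpace X]

lemma Tower.sepr {φ : ℕ → X → X} {T : ℕ → Set X}
    {K : ℕ → ℕ → Set X} {η θ D : ℕ → ℝ} (h : Tower φ T K η θ D) {xs ys : ℕ → X} {n : ℕ} {p q : X}
    (hx : ∀ i, n ≤ i → xs (i+1) = φ i (xs i)) (hy : ∀ i, n ≤ i → ys (i+1) = φ i (ys i))
    (hxT : ∀ m, n ≤ m → xs m ∈ T m → ∀ q ∈ K m m, D m ≤ dist (ys m) q)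
    (hyT : ∀ m, n ≤ m → ys m ∈ T m → ∀ q ∈ K m m, D m ≤ dist (xs m) q)
    (hne : xs n ≠ ys n) (hp : Tendsto xs atTop (𝓝 p)) (hq : Tendsto ys atTop (𝓝 q)) : p ≠ q := by
  have fin : ∀ k e, 0 < e → (∀ j, k < j → e ≤ dist (xs j) (ys j)) → p ≠ q := by
    intro k e he hh hpq
    have h1 : Tendsto (fun j => dist (xs j) (ys j)) atTop (𝓝 (dist p q)) := hp.dist hq
    have h2 : e ≤ dist p q := ge_of_tendsto h1 (by
      filter_upwards [eventually_gt_atTop k] with j hj using hh j hj)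
    rw [hpq, dist_self] at h2
    linarith
  by_cases hA : ∃ m, n ≤ m ∧ (xs m ∈ T m ∨ ys m ∈ T m)
  · obtain ⟨m, hm, hT | hT⟩ := hA
    · exact fin m (η m) (h.η_pos m) (fun j hj => h.apart (fun i hi => hx i (hm.trans hi))
        (fun i hi => hy i (hm.trans hi)) hT (hxT m hm hT) j hj)
    · refine fin m (η m) (h.η_pos m) (fun j hj => ?_)
      rw [dist_comm]
      exact h.apart (fun i hi => hy i (hm.trans hi))
        (fun i hi => hx i (hm.trans hi)) hT (hyT m hm hT) j hj
  · push Not at hA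
    have : ∀ j, n ≤ j → xs j = xs n ∧ ys j = ys n := by
      intro j hj
      induction j, hj using Nat.le_induction with
      | base => exact ⟨rfl, rfl⟩
      | succ m hm ih =>
        rw [hx m hm, hy m hm, h.T_out _ _ (hA m hm).1, h.T_out _ _ (hA m hm).2]
        exact ih
    refine fin n (dist (xs n) (ys n)) (dist_pos.2 hne) (fun j hj => ?_)
    rw [(this j hj.le).1, (this j hj.le).2]

theorem limit_thm [CompactSpace X] {I : Set ℕ} {c : ℕ → ℝ × (ℝ × ℝ) → X} {a : ℕ → Set X}
    (h : Arcs I c a) : ∃ (Ψ : X → X) (b : ℕ → ℝ × ℝ → X),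
      (∀ n ∈ I, ContinuousOn (b n) circS ∧
        ∀ p ∈ circS, ∀ q ∈ circS, (b n p = b n q ↔ (p.1 = q.1 ∨ p.1 = -q.1) ∧ p.2 = q.2)) ∧
      (∀ m ∈ I, ∀ n ∈ I, m ≠ n → Disjoint (b m '' circS) (b n '' circS)) ∧
      BijOn Ψ (⋃ n ∈ I, a n)ᶜ (⋃ n ∈ I, b n '' circS)ᶜ ∧ ContinuousOn Ψ (⋃ n ∈ I, a n)ᶜ ∧
      (∀ n ∈ I, ∀ p ∈ circS, Tendsto (fun q => Ψ (c n q)) (𝓝[Ioc 0 1 ×ˢ circS] ((0:ℝ), p)) (𝓝 (b n p))) ∧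
      ∀ ε > 0, {n | n ∈ I ∧ ¬ SmS (b n '' circS) ε}.Finite := by
  obtain ⟨Φ, B, τ, φ, b, T, C, η, θ, D, Φ0, B0, τ0, ΦS, BS, τS, hInv, hS⟩ := exists_tower h
  have tw : Tower φ T (fun k l => Φ k '' a l) η θ D :=
    { K_succ := fun k l _ => by simp only [ΦS, image_comp]
      T_out := fun k => (hS k).T_out
      T_in := fun k => (hS k).T_in
      T_sub := fun k => (hS k).T_sub
      θ_pos := fun k => (hS k).θ_pos
      θ_le := fun k => (hS k).θ_le
      η_succ := fun k => by rw [← τS]; exact (hS (k+1)).η_le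
      η_zero := by rw [← τ0]; exact (hS 0).η_le
      D_le := fun k => (hS k).D_le
      near := fun k l hkl p hp q hq hd => by
        simp only [ΦS, image_comp]
        exact (hS k).near l hkl p hp q hq hd
      sep := fun k l hkl hn => (hS k).sep l hkl hn
      contr := fun k => (hInv k).contr }
  have memO : ∀ x, x ∈ (⋃ n ∈ I, a n)ᶜ → ∀ k, x ∈ OO a k := by
    intro x hx k
    rw [mem_OO]
    intro n _ hxn
    by_cases hn : n ∈ I
    · exact hx (mem_biUnion hn hxn)
    · rw [h.emp n hn] at hxn; exact hxn
  have orb : ∀ x, ∀ i, Φ (i+1) x = φ i (Φ i x) := fun x i => by rw [ΦS]; rfl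
  have hlim : ∀ x, ∃ y, Tendsto (fun j => Φ j x) atTop (𝓝 y) := by
    intro x
    apply cauchySeq_tendsto_of_complete
    rw [Metric.cauchySeq_iff']
    intro ε hε
    obtain ⟨N, _, hN⟩ := tw.tail (half_pos hε)
    refine ⟨N, fun j hj => ?_⟩
    have := hN N le_rfl (fun j => Φ j x) (fun i _ => orb x i) j hj
    linarith
  choose Ψ hΨ using hlim
  have unif : ∀ ε > 0, ∃ N, ∀ m, N ≤ m → (∀ x, ∀ j, m ≤ j → dist (Φ j x) (Φ m x) ≤ ε) ∧
      ∀ x, dist (Ψ x) (Φ m x) ≤ ε := by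
    intro ε hε
    obtain ⟨N, _, hN⟩ := tw.tail hε
    refine ⟨N, fun m hm => ?_⟩
    have h1 : ∀ x, ∀ j, m ≤ j → dist (Φ j x) (Φ m x) ≤ ε := fun x j hj =>
      hN m hm (fun j => Φ j x) (fun i _ => orb x i) j hj
    refine ⟨h1, fun x => ?_⟩
    refine le_of_tendsto ((hΨ x).dist tendsto_const_nhds) ?_
    filter_upwards [eventually_ge_atTop m] with j hj using h1 x j hj
  have Bmono : ∀ m n, m ≤ n → B m ⊆ B n := by
    intro m n hmn
    induction n, hmn using Nat.le_induction with
    | base => exact le_rfl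
    | succ k _ ih => rw [BS]; exact ih.trans subset_union_left
  have CB : ∀ k m, k < m → C k ⊆ B m := fun k m hkm =>
    (show C k ⊆ B (k+1) by rw [BS]; exact subset_union_right).trans (Bmono _ _ hkm)
  have BC : ∀ n y, y ∈ B n → ∃ k, y ∈ C k := by
    intro n
    induction n with
    | zero => intro y hy; rw [B0] at hy; exact hy.elim
    | succ k ih =>
      intro y hy
      rw [BS] at hy
      rcases hy with hy | hy
      · exact ih y hy
      · exact ⟨k, hy⟩
  have BT : ∀ m, ∀ y ∈ B m, y ∉ T m := by
    intro m y hy hT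
    obtain ⟨q, hq, hd⟩ := (hS m).T_sub y hT
    have := (hS m).V_B y hy q hq
    have := (hS m).D_le
    have := (hS m).θ_le
    have := (hS m).θ_pos
    linarith
  have C_I : (⋃ n ∈ I, b n '' circS) = ⋃ n, C n := by
    ext y
    simp only [mem_iUnion]
    constructor
    · rintro ⟨n, hn, hy⟩
      exact ⟨n, by rw [(hS n).C_in hn]; exact hy⟩
    · rintro ⟨n, hy⟩
      by_cases hn : n ∈ I
      · exact ⟨n, hn, by rw [← (hS n).C_in hn]; exact hy⟩
      · rw [(hS n).C_out hn] at hy; exact hy.elim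
  have hcont : ContinuousOn Ψ (⋃ n ∈ I, a n)ᶜ := by
    have : TendstoUniformlyOn Φ Ψ atTop (⋃ n ∈ I, a n)ᶜ := by
      rw [Metric.tendstoUniformlyOn_iff]
      intro ε hε
      obtain ⟨N, hN⟩ := unif (ε/2) (by positivity)
      filter_upwards [eventually_ge_atTop N] with m hm x _
      have := (hN m hm).2 x
      linarith
    exact this.continuousOn (Eventually.frequently (Eventually.of_forall (fun m =>
      (hInv m).cont.mono (fun x hx => memO x hx m))))
  have htend : ∀ n ∈ I, ∀ p ∈ circS,
      Tendsto (fun q => Ψ (c n q)) (𝓝[Ioc 0 1 ×ˢ circS] ((0:ℝ), p)) (𝓝 (b n p)) := by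
    intro n hn p hp
    have hbC : b n p ∈ C n := by rw [(hS n).C_in hn]; exact ⟨p, hp, rfl⟩
    have h1 : ∀ m, n < m → Tendsto (fun q => Φ m (c n q)) (𝓝[Ioc 0 1 ×ˢ circS] ((0:ℝ), p)) (𝓝 (b n p)) := by
      intro m hm
      induction m, hm using Nat.le_induction with
      | base =>
        simp only [ΦS]
        exact (hS n).tend hn p hp
      | succ m hm ih =>
        refine ih.congr' ?_
        have hB := CB n m hm hbC
        have h99 : 0 < D m - θ m := by
          have := (hS m).D_le
          have := (hS m).θ_le
          have := (hS m).θ_pos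
          linarith
        filter_upwards [Metric.tendsto_nhds.1 ih _ h99] with q hq
        rw [orb, (hS m).T_out]
        intro hT
        obtain ⟨z, hz, hd⟩ := (hS m).T_sub _ hT
        have e1 := (hS m).V_B _ hB z hz
        have e2 := dist_triangle_left (b n p) z (Φ m (c n q))
        linarith
    rw [Metric.tendsto_nhds]
    intro ε hε
    obtain ⟨N, hN⟩ := unif (ε/2) (by positivity)
    have h2 := (hN (max N (n+1)) (le_max_left _ _)).2
    have h3 := h1 (max N (n+1)) (Nat.lt_of_succ_le (le_max_right _ _))
    filter_upwards [Metric.tendsto_nhds.1 h3 (ε/2) (by positivity)] with q hq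
    have := h2 (c n q)
    have := dist_triangle (Ψ (c n q)) (Φ (max N (n+1)) (c n q)) (b n p)
    linarith
  have hdist : ∀ m n, m < n → Disjoint (C m) (C n) := by
    intro m n hmn
    rw [disjoint_left]
    intro y hy hy'
    exact BT n y (CB m n hmn hy) ((hS n).C_T hy')
  have hTV : ∀ x y : X, ∀ m, Φ m x ∈ T m → (¬ ∀ q ∈ Φ m '' a m, D m ≤ dist (Φ m y) q) →
      x ∈ OO a m → y ∈ OO a m → ∃ q ∈ a m, ∃ q' ∈ a m, dist x q < 1 / (m + 1 : ℝ) ∧ dist y q' < 1 / (m + 1 : ℝ) := by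
    intro x y m hx hy hxO hyO
    push Not at hy
    obtain ⟨q', hq', hd'⟩ := hy
    obtain ⟨q, hq, hd⟩ := (hS m).T_sub _ hx
    have e1 := (hS m).D_le
    have e2 := (hS m).θ_le
    have e3 := (hS m).θ_pos
    obtain ⟨z, hz, hzd⟩ := (hS m).V_in x hxO q hq (by linarith)
    obtain ⟨z', hz', hzd'⟩ := (hS m).V_in y hyO q' hq' hd'
    exact ⟨z, hz, z', hz', hzd, hzd'⟩
  refine ⟨Ψ, b, fun n hn => ⟨(hS n).b_cont hn, (hS n).b_iff hn⟩, ?_, ⟨?_, ?_, ?_⟩, hcont, htend, ?_⟩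
  · intro m hm n hn hmn
    rw [← (hS m).C_in hm, ← (hS n).C_in hn]
    rcases lt_or_gt_of_ne hmn with h1 | h1
    · exact hdist m n h1
    · exact (hdist n m h1).symm
  · intro x hx hxC
    rw [C_I] at hxC
    obtain ⟨k, hk⟩ := mem_iUnion.1 hxC
    have hBm : ∀ m, k + 1 ≤ m → Ψ x ∈ B m := fun m hm => CB k m hm hk
    refine tw.sepr (xs := fun j => Φ j x) (ys := fun _ => Ψ x) (n := k+1) (fun i _ => orb x i) ?_ ?_ ?_ ?_
      (hΨ x) tendsto_const_nhds rfl
    · intro i hi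
      exact ((hS i).T_out _ (BT i _ (hBm i hi))).symm
    · intro m hm _ q hq
      exact (hS m).V_B _ (hBm m hm) q hq
    · intro m hm hT
      exact (BT m _ (hBm m hm) hT).elim
    · intro he
      exact (hInv (k+1)).bij.mapsTo (memO x hx (k+1)) (he ▸ hBm (k+1) le_rfl)
  · intro x hx y hy he
    by_contra hne
    have hd : 0 < dist x y := dist_pos.2 hne
    obtain ⟨M, hM⟩ := (h.contr (dist x y / 4) (by positivity)).bddAbove
    obtain ⟨N, hN⟩ := exists_nat_gt (4 / dist x y)
    have hno : ∀ m, max (M+1) N ≤ m → ¬ ∃ q ∈ a m, ∃ q' ∈ a m, dist x q < 1 / (m + 1 : ℝ) ∧ dist y q' < 1 / (m + 1 : ℝ) := by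
      rintro m hm ⟨q, hq, q', hq', d1, d2⟩
      have hsm : SmS (a m) (dist x y / 4) := by
        by_contra hcc
        have := hM hcc
        have := le_max_left (M+1) N
        omega
      have e1 := hsm q hq q' hq'
      have hmN : (N:ℝ) ≤ m := by exact_mod_cast (le_max_right _ _).trans hm
      have e2 : 1 / (m + 1 : ℝ) < dist x y / 4 := by
        rw [div_lt_iff₀ (by positivity)]
        rw [div_lt_iff₀ hd] at hN
        nlinarith
      have e3 := dist_triangle4 x q q' y
      rw [dist_comm q' y] at e3
      linarith
    refine tw.sepr (xs := fun j => Φ j x) (ys := fun j => Φ j y) (n := max (M+1) N) (fun i _ => orb x i)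
      (fun i _ => orb y i) ?_ ?_ ?_ (hΨ x) (hΨ y) he
    · intro m hm hT
      by_contra hcc
      exact hno m hm (hTV x y m hT hcc (memO x hx m) (memO y hy m))
    · intro m hm hT
      by_contra hcc
      obtain ⟨q, hq, q', hq', d1, d2⟩ := hTV y x m hT hcc (memO y hy m) (memO x hx m)
      exact hno m hm ⟨q', hq', q, hq, d2, d1⟩
    · intro he'
      exact hne ((hInv _).bij.injOn (memO x hx _) (memO y hy _) he')
  · intro y hy
    rw [C_I] at hy
    have hyB : ∀ n, y ∈ (B n)ᶜ := by
      intro n hn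
      obtain ⟨k, hk⟩ := BC n y hn
      exact hy (mem_iUnion.2 ⟨k, hk⟩)
    have hx : ∀ n, ∃ x ∈ OO a n, Φ n x = y := fun n => (hInv n).bij.surjOn (hyB n)
    choose xs xsO hxs using hx
    obtain ⟨x, -, ψ, ψm, hψ⟩ := (isCompact_univ (X := X)).tendsto_subseq (fun n => mem_univ (xs n))
    have hΨy : Tendsto (fun n => Ψ (xs n)) atTop (𝓝 y) := by
      rw [Metric.tendsto_atTop]
      intro ε hε
      obtain ⟨N, hN⟩ := unif (ε/2) (by positivity)
      refine ⟨N, fun n hn => ?_⟩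
      have := (hN n hn).2 (xs n)
      rw [hxs] at this
      linarith
    by_cases hxA : x ∈ (⋃ n ∈ I, a n)ᶜ
    · refine ⟨x, hxA, ?_⟩
      apply eq_of_forall_dist_le
      intro ε hε
      obtain ⟨N, hN⟩ := unif (ε/2) (by positivity)
      have h1 : ContinuousAt (Φ N) x := (hInv N).cont.continuousAt ((h.open_OO N).mem_nhds (memO x hxA N))
      have h2 : Tendsto (fun n => Φ N (xs (ψ n))) atTop (𝓝 (Φ N x)) := h1.tendsto.comp hψ
      have h3 : dist (Φ N x) y ≤ ε/2 := by
        refine le_of_tendsto (h2.dist tendsto_const_nhds) ?_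
        filter_upwards [eventually_ge_atTop N] with n hn
        have := (hN N le_rfl).1 (xs (ψ n)) (ψ n) (hn.trans (ψm.id_le n))
        rw [hxs, dist_comm] at this
        exact this
      have := (hN N le_rfl).2 x
      have := dist_triangle (Ψ x) (Φ N x) y
      linarith
    · exfalso
      rw [notMem_compl_iff] at hxA
      simp only [mem_iUnion] at hxA
      obtain ⟨k, hk, hxk⟩ := hxA
      have hcol := h.col k hk
      have hxk' := hxk
      rw [h.arc k hk] at hxk
      obtain ⟨u, hu, rfl⟩ := hxk
      have hop := hcol.opn 1 one_pos le_rfl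
      have hev : ∀ᶠ n in atTop, xs (ψ n) ∈ c k '' (Ioc 0 1 ×ˢ circS) := by
        filter_upwards [hψ (hop.mem_nhds ⟨(0, u), ⟨⟨le_rfl, one_pos⟩, hu⟩, rfl⟩),
          eventually_gt_atTop k] with n hn hkn
        obtain ⟨q, hq, he⟩ := hn
        refine ⟨q, ⟨⟨?_, hq.1.2.le⟩, hq.2⟩, he⟩
        rcases hq.1.1.eq_or_lt with h0 | h0
        · exfalso
          have h1 := mem_OO.1 (xsO (ψ n)) k (hkn.trans_le (ψm.id_le n))
          apply h1
          rw [h.arc k hk]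
          exact ⟨q.2, hq.2, by simp only; rw [show xs (ψ n) = c k q from he.symm]; congr 1; exact Prod.ext h0 rfl⟩
        · exact h0
      obtain ⟨N, hN⟩ := eventually_atTop.1 hev
      have hN' : ∀ n, ∃ q ∈ Ioc (0:ℝ) 1 ×ˢ circS, c k q = xs (ψ (N + n)) := fun n => hN (N+n) (by omega)
      choose qs hqs hqe using hN'
      have hIC : ∀ n, qs n ∈ Cyl 1 := fun n => ⟨Ioc_subset_Icc_self (hqs n).1, (hqs n).2⟩
      obtain ⟨q, hq, χ, χm, hχ⟩ := (Cyl_compact 1).tendsto_subseq hIC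
      have hsub2 : Tendsto (fun n => N + χ n) atTop atTop :=
        tendsto_atTop_mono (fun n => by
          have := χm.id_le n
          simp only [id] at this ⊢; omega) tendsto_id
      have hsub : Tendsto (fun n => ψ (N + χ n)) atTop atTop := ψm.tendsto_atTop.comp hsub2
      have hχ' : Tendsto (qs ∘ χ) atTop (𝓝[Cyl 1] q) :=
        tendsto_nhdsWithin_iff.2 ⟨hχ, Eventually.of_forall (fun n => hIC _)⟩
      have l1 : Tendsto (fun n => c k (qs (χ n))) atTop (𝓝 (c k q)) := (hcol.cont q hq).tendsto.comp hχ'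
      have l2 : Tendsto (fun n => c k (qs (χ n))) atTop (𝓝 (c k (0, u))) := by
        simp only [hqe]
        exact hψ.comp hsub2
      have e := tendsto_nhds_unique l1 l2
      have q0 := (hcol.inj q hq (0, u) ⟨⟨le_rfl, zero_le_one⟩, hu⟩ e).1
      have hqq : q = (0, q.2) := Prod.ext q0 rfl
      have hχ2 : Tendsto (qs ∘ χ) atTop (𝓝[Ioc 0 1 ×ˢ circS] ((0:ℝ), q.2)) := by
        rw [← hqq]
        exact tendsto_nhdsWithin_iff.2 ⟨hχ, Eventually.of_forall (fun n => hqs _)⟩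
      have l3 : Tendsto (fun n => Ψ (c k (qs (χ n)))) atTop (𝓝 (b k q.2)) := (htend k hk q.2 hq.2).comp hχ2
      have l4 : Tendsto (fun n => Ψ (c k (qs (χ n)))) atTop (𝓝 y) := by
        simp only [hqe]
        exact hΨy.comp hsub
      have := tendsto_nhds_unique l3 l4
      apply hy
      refine mem_iUnion.2 ⟨k, ?_⟩
      rw [(hS k).C_in hk]
      exact ⟨q.2, hq.2, this⟩
  · intro ε hε
    obtain ⟨N, hN, _⟩ := tw.tail hε
    refine (finite_lt_nat N).subset ?_
    rintro n ⟨hn, hns⟩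
    by_contra hcc
    simp only [mem_ofPred_eq, not_lt] at hcc
    apply hns
    rw [← (hS n).C_in hn]
    exact fun x hx y hy => hN n hcc x ((hS n).C_T hx) y ((hS n).C_T hy)

end

end SecG

section SecH
def scl (q : ℝ × (ℝ × ℝ)) : ℝ × ℝ := ((1 + q.1) * q.2.1, (1 + q.1) * q.2.2)

def nsq (p : ℝ × ℝ) : ℝ := p.1 ^ 2 + p.2 ^ 2

def pol (p : ℝ × ℝ) : ℝ × (ℝ × ℝ) := (√(nsq p) - 1, (p.1 / √(nsq p), p.2 / √(nsq p)))

lemma nsq_scl {q : ℝ × (ℝ × ℝ)} (hq : q.2 ∈ circS) : nsq (scl q) = (1 + q.1) ^ 2 := by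
  simp only [circS, mem_ofPred_eq] at hq
  simp only [nsq, scl]
  linear_combination (1 + q.1) ^ 2 * hq

lemma pol_circ {p : ℝ × ℝ} (hp : 0 < nsq p) : (pol p).2 ∈ circS := by
  have h1 : 0 < √(nsq p) := Real.sqrt_pos.2 hp
  have h2 : √(nsq p) ^ 2 = nsq p := Real.sq_sqrt hp.le
  simp only [circS, mem_ofPred_eq, pol, div_pow, h2]
  rw [← add_div]
  exact div_self hp.ne'

lemma scl_pol {p : ℝ × ℝ} (hp : 0 < nsq p) : scl (pol p) = p := by
  have h1 : 0 < √(nsq p) := Real.sqrt_pos.2 hp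
  simp only [scl, pol]
  ext <;> simp only [add_sub_cancel] <;> exact mul_div_cancel₀ _ h1.ne'

lemma mem_dInf {p : ℝ × ℝ} : (p : OP) ∈ deltaInf ↔ 1 < nsq p := by
  simp only [deltaInf, deltaBar, circOP, circS, Set.mem_sdiff, mem_insert_iff, OnePoint.coe_ne_infty, false_or,
    mem_image, mem_ofPred_eq, OnePoint.coe_eq_coe, exists_eq_right, nsq]
  constructor
  · rintro ⟨h1, h2⟩; exact lt_of_le_of_ne h1 (Ne.symm h2)
  · intro h; exact ⟨h.le, h.ne'⟩

lemma mem_dBar {p : ℝ × ℝ} : (p : OP) ∈ deltaBar ↔ 1 ≤ nsq p := by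
  simp only [deltaBar, mem_insert_iff, OnePoint.coe_ne_infty, false_or,
    mem_image, mem_ofPred_eq, OnePoint.coe_eq_coe, exists_eq_right, nsq]

lemma inf_dInf : (∞ : OP) ∈ deltaInf := by
  simp [deltaInf, deltaBar, circOP]

lemma ext_collar {α : ℝ × ℝ → Sph} {ext : OP → Sph} (hα : IsAlphaPath α) (he : IsExtension α ext) :
    Collar (fun q => ext (scl q : OP)) 1 := by
  obtain ⟨ec, eα, ee, ei⟩ := he
  have einj : ∀ z ∈ deltaInf, ∀ w ∈ deltaInf, ext z = ext w → z = w := fun z hz w hw h =>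
    congrArg Subtype.val (ee.injective (a₁ := ⟨z, hz⟩) (a₂ := ⟨w, hw⟩) h)
  have enot : ∀ z ∈ deltaInf, ext z ∉ pathIm α := fun z hz => by
    have : ext z ∈ (pathIm α)ᶜ := ei ▸ mem_image_of_mem ext hz
    exact this
  have scl0 : ∀ u : ℝ × ℝ, scl (0, u) = u := fun u => by simp [scl]
  have hpos : ∀ q ∈ Cyl 1, 0 < q.1 → (scl q : OP) ∈ deltaInf := by
    intro q hq h
    rw [mem_dInf, nsq_scl hq.2]; nlinarith
  have hzero : ∀ q ∈ Cyl 1, q.1 = 0 → ext (scl q : OP) = α q.2 := by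
    intro q hq h
    rw [show q = (0, q.2) from Prod.ext h rfl, scl0]
    exact eα _ hq.2
  have hzero' : ∀ q ∈ Cyl 1, q.1 = 0 → ext (scl q : OP) ∈ pathIm α := by
    intro q hq h
    rw [hzero q hq h]; exact ⟨_, hq.2, rfl⟩
  have sclc : Continuous scl := by unfold scl; fun_prop
  refine ⟨one_pos, le_rfl, ?_, ?_, ?_, ?_⟩
  · refine ec.comp (OnePoint.continuous_coe.comp sclc).continuousOn ?_
    intro q hq
    show (scl q : OP) ∈ deltaBar
    rw [mem_dBar, nsq_scl hq.2]
    nlinarith [hq.1.1]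
  · intro q hq q' hq' h
    rcases hq.1.1.eq_or_lt with h0 | h0 <;> rcases hq'.1.1.eq_or_lt with h0' | h0'
    · rw [hzero q hq h0.symm, hzero q' hq' h0'.symm] at h
      obtain ⟨h1, h2⟩ := (hα.2 _ hq.2 _ hq'.2).1 h
      exact ⟨by rw [← h0, ← h0'], h1, h2.imp id (fun h => ⟨h0.symm, h⟩)⟩
    · exact (enot _ (hpos q' hq' h0') (h ▸ hzero' q hq h0.symm)).elim
    · exact (enot _ (hpos q hq h0) (h ▸ hzero' q' hq' h0'.symm)).elim
    · have := einj _ (hpos q hq h0) _ (hpos q' hq' h0') h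
      rw [OnePoint.coe_eq_coe] at this
      have hn := congrArg nsq this
      rw [nsq_scl hq.2, nsq_scl hq'.2] at hn
      have hs : q.1 = q'.1 := by
        have := (sq_eq_sq₀ (by linarith) (by linarith)).1 hn
        linarith
      simp only [scl, Prod.mk.injEq, hs] at this
      have h1 : (1 + q'.1) ≠ 0 := by linarith
      exact ⟨hs, mul_left_cancel₀ h1 this.1, Or.inl (mul_left_cancel₀ h1 this.2)⟩
  · intro u hu
    simp only [scl0]
    rw [eα u hu, eα _ (conj_circ hu)]
    exact (hα.2 _ hu _ (conj_circ hu)).2 ⟨rfl, Or.inr (by simp)⟩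
  · intro r r0 r1
    set G : Set OP := (fun p : ℝ × ℝ => (p : OP)) '' {p | nsq p < (1 + r) ^ 2} with hG
    have hGo : IsOpen G := by
      apply OnePoint.isOpenEmbedding_coe.isOpenMap
      exact isOpen_lt (by unfold nsq; fun_prop) continuous_const
    have hF : ∀ z, z ∈ Gᶜ → z ∈ deltaInf := by
      intro z hz
      induction z using OnePoint.rec with
      | infty => exact inf_dInf
      | coe p =>
        rw [mem_dInf]
        by_contra hn
        apply hz
        refine ⟨p, ?_, rfl⟩
        simp only [mem_ofPred_eq]
        nlinarith
    have hcl : IsClosed (ext '' Gᶜ) := by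
      apply IsCompact.isClosed
      apply hGo.isClosed_compl.isCompact.image_of_continuousOn
      exact ec.mono (fun z hz => (hF z hz).1)
    have : (fun q => ext (scl q : OP)) '' (Ico 0 r ×ˢ circS) = (ext '' Gᶜ)ᶜ := by
      apply Subset.antisymm
      · rintro _ ⟨q, hq, rfl⟩ ⟨w, hw, h⟩
        simp only at h
        have hqC : q ∈ Cyl 1 := ⟨⟨hq.1.1, hq.1.2.le.trans r1⟩, hq.2⟩
        rcases hq.1.1.eq_or_lt with h0 | h0
        · exact enot w (hF w hw) (h ▸ hzero' q hqC h0.symm)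
        · have := einj _ (hF w hw) _ (hpos q hqC h0) h
          apply hw
          rw [this]
          refine ⟨_, ?_, rfl⟩
          simp only [mem_ofPred_eq, nsq_scl hq.2]
          have := hq.1.2
          gcongr
      · intro x hx
        by_cases hxp : x ∈ pathIm α
        · obtain ⟨u, hu, rfl⟩ := hxp
          exact ⟨(0, u), ⟨⟨le_rfl, r0⟩, hu⟩, by simp only [scl0]; exact eα u hu⟩
        · have : x ∈ ext '' deltaInf := by rw [ei]; exact hxp
          obtain ⟨z, hz, rfl⟩ := this
          have hzG : z ∈ G := by
            by_contra hn
            exact hx ⟨z, hn, rfl⟩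
          obtain ⟨p, hp, rfl⟩ := hzG
          simp only [mem_ofPred_eq] at hp
          have hz' := mem_dInf.1 hz
          have hp0 : 0 < nsq p := by linarith
          refine ⟨pol p, ⟨⟨?_, ?_⟩, pol_circ hp0⟩, by simp only [scl_pol hp0]⟩
          · simp only [pol, sub_nonneg]
            rw [Real.one_le_sqrt]; exact hz'.le
          · simp only [pol]
            have := (Real.sqrt_lt' (by linarith : 0 < 1 + r)).2 hp
            linarith
    rw [this]
    exact hcl.isOpen_compl

lemma pol_tendsto {Y : Type*} [TopologicalSpace Y] {F : OP → Y} {y : Y} {p : ℝ × ℝ} (hp : p ∈ circS)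
    {s : Set OP} (hs : s ⊆ deltaInf)
    (h : Tendsto (fun q => F (scl q : OP)) (𝓝[Ioc 0 1 ×ˢ circS] ((0:ℝ), p)) (𝓝 y)) :
    Tendsto F (𝓝[s] (p : OP)) (𝓝 y) := by
  refine Tendsto.mono_left ?_ (nhdsWithin_mono _ hs)
  rw [OnePoint.nhdsWithin_coe, tendsto_map'_iff]
  have hn1 : nsq p = 1 := hp
  have hcn : Continuous nsq := by unfold nsq; fun_prop
  have hc : ContinuousAt pol p := by
    unfold pol
    have h1 : √(nsq p) ≠ 0 := by rw [hn1]; simp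
    have h2 : ContinuousAt (fun p => √(nsq p)) p := (Real.continuous_sqrt.comp hcn).continuousAt
    exact (h2.sub continuousAt_const).prodMk
      ((continuousAt_fst.div h2 h1).prodMk (continuousAt_snd.div h2 h1))
  have hpp : pol p = (0, p) := by simp [pol, hn1]
  have hin : ∀ᶠ w in 𝓝[(fun p : ℝ × ℝ => (p : OP)) ⁻¹' deltaInf] p, 1 < nsq w := by
    filter_upwards [self_mem_nhdsWithin] with w hw
    exact mem_dInf.1 hw
  have ht : Tendsto pol (𝓝[(fun p : ℝ × ℝ => (p : OP)) ⁻¹' deltaInf] p) (𝓝[Ioc 0 1 ×ˢ circS] ((0:ℝ), p)) := by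
    rw [tendsto_nhdsWithin_iff]
    constructor
    · rw [← hpp]; exact hc.tendsto.mono_left nhdsWithin_le_nhds
    · have h4 : ∀ᶠ w in 𝓝 p, nsq w < 4 :=
        hcn.continuousAt.eventually_lt continuousAt_const (by rw [hn1]; norm_num)
      filter_upwards [hin, nhdsWithin_le_nhds h4] with w h1 h2
      refine ⟨⟨?_, ?_⟩, pol_circ (by linarith)⟩
      · simp only [pol, sub_pos]
        exact Real.lt_sqrt_of_sq_lt (by linarith)
      · simp only [pol]
        have := (Real.sqrt_le_left (y := 2) (by norm_num)).2 (show nsq w ≤ 2 ^ 2 by linarith)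
        linarith
  refine (h.comp ht).congr' ?_
  filter_upwards [hin] with w hw
  simp only [Function.comp, scl_pol (show 0 < nsq w by linarith)]

end SecH

/-- Every countable contracted set `𝒜` of disjoint α-paths (with chosen
extensions) admits a regluing into some set `ℬ` of disjoint β-paths; moreover `ℬ` can be
chosen to be contracted. -/
theorem exists_regluing (A : Set (ℝ × ℝ → Sph)) (ext : (ℝ × ℝ → Sph) → OP → Sph)
    (hA : A.Countable) (halpha : ∀ α ∈ A, IsAlphaPath α) (hdisj : DisjointPaths A)
    (hext : ∀ α ∈ A, IsExtension α (ext α)) (hcontr : Contracted (pathIm '' A)) :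
    ∃ (B : Set (ℝ × ℝ → Sph)) (b : (ℝ × ℝ → Sph) → ℝ × ℝ → Sph) (Φ : Sph → Sph),
      RegluingData A ext B b ∧ IsRegluing A ext B b Φ ∧ Contracted (pathIm '' B) := by
  classical
  haveI : Nonempty Sph := ((NormedSpace.sphere_nonempty (E := EuclideanSpace ℝ (Fin 3)) (x := 0)).2 zero_le_one).to_subtype
  obtain ⟨f, hf⟩ := Set.countable_iff_exists_injOn.1 hA
  set g : ℕ → ℝ × ℝ → Sph := Function.invFunOn f A with hg
  have gf : ∀ α ∈ A, g (f α) = α := fun α hα => hf.leftInvOn_invFunOn hα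
  set I : Set ℕ := f '' A with hI
  have hgI : ∀ n ∈ I, g n ∈ A ∧ f (g n) = n := by
    rintro _ ⟨α, hα, rfl⟩
    rw [gf α hα]; exact ⟨hα, rfl⟩
  have circ_ne : circS.Nonempty := ⟨(1, 0), by simp [circS]⟩
  have pne : ∀ α, (pathIm α).Nonempty := fun α => circ_ne.image α
  have pinj : ∀ α ∈ A, ∀ α' ∈ A, pathIm α = pathIm α' → α = α' := by
    intro α hα α' hα' he
    by_contra hne
    have := hdisj hα hα' hne
    simp only at this
    rw [he, disjoint_self] at this
    exact (pne α').ne_empty this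
  set a : ℕ → Set Sph := fun n => if n ∈ I then pathIm (g n) else ∅ with ha
  have aI : ∀ n ∈ I, a n = pathIm (g n) := fun n hn => if_pos hn
  have aE : ∀ n, n ∉ I → a n = ∅ := fun n hn => if_neg hn
  have hAr : Arcs I (fun n q => ext (g n) (scl q : OP)) a := by
    refine ⟨?_, ?_, aE, ?_, ?_⟩
    · intro n hn
      exact ext_collar (halpha _ (hgI n hn).1) (hext _ (hgI n hn).1)
    · intro n hn
      rw [aI n hn]
      refine image_congr (fun u hu => ?_)
      have : scl (0, u) = u := by simp [scl]
      simp only [this]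
      exact ((hext _ (hgI n hn).1).2.1 u hu).symm
    · intro m n hmn
      by_cases hm : m ∈ I
      · by_cases hn : n ∈ I
        · rw [aI m hm, aI n hn]
          refine hdisj (hgI m hm).1 (hgI n hn).1 (fun he => hmn ?_)
          rw [← (hgI m hm).2, he, (hgI n hn).2]
        · rw [aE n hn]; exact disjoint_bot_right
      · rw [aE m hm]; exact disjoint_bot_left
    · intro ε hε
      have h1 : {α | α ∈ A ∧ ε < Metric.diam (pathIm α)}.Finite := by
        refine Set.Finite.of_finite_image (f := pathIm) ((hcontr ε hε).subset ?_) ?_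
        · rintro _ ⟨α, ⟨h1, h2⟩, rfl⟩
          exact ⟨⟨α, h1, rfl⟩, h2⟩
        · intro α hα α' hα' he
          exact pinj α hα.1 α' hα'.1 he
      refine (h1.image f).subset ?_
      intro n hn
      by_cases hnI : n ∈ I
      · refine ⟨g n, ⟨(hgI n hnI).1, ?_⟩, (hgI n hnI).2⟩
        by_contra hcc
        push Not at hcc
        apply hn
        rw [aI n hnI]
        intro x hx y hy
        exact (Metric.dist_le_diam_of_mem (isCompact_univ.isBounded.subset (subset_univ _)) hx hy).trans hcc
      · exfalso
        apply hn
        rw [aE n hnI]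
        intro x hx
        exact hx.elim
  obtain ⟨Ψ, b, b1, b2, b3, b4, b5, b6⟩ := limit_thm hAr
  have fA : ∀ α ∈ A, f α ∈ I := fun α hα => ⟨α, hα, rfl⟩
  have imA : famIm A = ⋃ n ∈ I, a n := by
    ext x
    simp only [famIm, mem_iUnion]
    constructor
    · rintro ⟨α, hα, hx⟩
      exact ⟨f α, fA α hα, by rw [aI _ (fA α hα), gf α hα]; exact hx⟩
    · rintro ⟨n, hn, hx⟩
      exact ⟨g n, (hgI n hn).1, by rw [← aI n hn]; exact hx⟩
  have imB : famIm ((fun α => b (f α)) '' A) = ⋃ n ∈ I, b n '' circS := by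
    ext x
    simp only [famIm, mem_iUnion]
    constructor
    · rintro ⟨_, ⟨α, hα, rfl⟩, hx⟩
      exact ⟨f α, fA α hα, hx⟩
    · rintro ⟨_, ⟨α, hα, rfl⟩, hx⟩
      exact ⟨b (f α), ⟨α, hα, rfl⟩, hx⟩
  refine ⟨(fun α => b (f α)) '' A, fun α => b (f α), Ψ, ⟨halpha, hdisj, hext, ?_, ?_, ?_⟩,
    ⟨?_, ?_, ?_⟩, ?_⟩
  · rintro _ ⟨α, hα, rfl⟩
    exact b1 _ (fA α hα)
  · rintro _ ⟨α, hα, rfl⟩ _ ⟨α', hα', rfl⟩ hne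
    exact b2 _ (fA α hα) _ (fA α' hα') (fun he => hne (by simp only [he]))
  · refine ⟨fun α hα => ⟨α, hα, rfl⟩, ?_, fun β hβ => hβ⟩
    intro α hα α' hα' he
    by_contra hne
    have := b2 _ (fA α hα) _ (fA α' hα') (fun hh => hne (hf hα hα' hh))
    simp only at he
    rw [he, disjoint_self] at this
    exact (circ_ne.image _).ne_empty this
  · rw [imA, imB]; exact b3
  · rw [imA]; exact b4
  · intro α hα p hp
    have h1 := b5 _ (fA α hα) p hp
    simp only [gf α hα] at h1
    exact pol_tendsto (F := fun z => Ψ (ext α z)) hp inter_subset_left h1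
  · intro ε hε
    refine ((b6 ε hε).image (fun n => b n '' circS)).subset ?_
    rintro _ ⟨⟨_, ⟨α, hα, rfl⟩, rfl⟩, hd⟩
    refine ⟨f α, ⟨fA α hα, fun hsm => ?_⟩, rfl⟩
    exact absurd (Metric.diam_le_of_forall_dist_le hε.le hsm) (not_le.2 hd)
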